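/- arXiv:2509.23995 — 3 statements merged into one kernel-verified Lean document; each statement's English description precedes it below -/
import Mathlib

section
/- For θ, θ′ ∈ (0,1], the norms ‖f‖_θ = θ‖(D⊗D)f‖_M + (1−θ)‖∇f‖_M are equivalent on the space of functions f of the form f = (u⊗u)∗m with m a finite signed measure on [0,1]^2 and f supported in [0,1]^2: there exists C > 0 such that ‖f‖_θ ≤ C ‖f‖_{θ′} for all such f. -/
open MeasureTheory Set Filter

noncomputable section

abbrev K2 : Set (ℝ × ℝ) := Icc (0:ℝ) 1 ×ˢ Icc (0:ℝ) 1

def TV (m : SignedMeasure (ℝ × ℝ)) : ℝ := (m.totalVariation univ).toReal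

def sInt (m : SignedMeasure (ℝ × ℝ)) (φ : ℝ × ℝ → ℝ) : ℝ :=
  ∫ x, φ x ∂m.toJordanDecomposition.posPart - ∫ x, φ x ∂m.toJordanDecomposition.negPart

def IsTest (φ : ℝ × ℝ → ℝ) : Prop := ContDiff ℝ (⊤ : ℕ∞) φ ∧ HasCompactSupport φ

def pd1 (φ : ℝ × ℝ → ℝ) : ℝ × ℝ → ℝ := fun x => fderiv ℝ φ x (1, 0)
def pd2 (φ : ℝ × ℝ → ℝ) : ℝ × ℝ → ℝ := fun x => fderiv ℝ φ x (0, 1)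

def IsDeriv1 (f : ℝ × ℝ → ℝ) (ν : SignedMeasure (ℝ × ℝ)) : Prop :=
  ∀ φ, IsTest φ → ∫ x, f x * pd1 φ x = - sInt ν φ

def IsDeriv2 (f : ℝ × ℝ → ℝ) (ν : SignedMeasure (ℝ × ℝ)) : Prop :=
  ∀ φ, IsTest φ → ∫ x, f x * pd2 φ x = - sInt ν φ

def IsMixedDeriv (f : ℝ × ℝ → ℝ) (m : SignedMeasure (ℝ × ℝ)) : Prop :=
  ∀ φ, IsTest φ → ∫ x, f x * pd1 (pd2 φ) x = sInt m φ

def SuppIn (m : SignedMeasure (ℝ × ℝ)) (s : Set (ℝ × ℝ)) : Prop :=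
  m.totalVariation sᶜ = 0

def MemM0 (f : ℝ × ℝ → ℝ) (m : SignedMeasure (ℝ × ℝ)) : Prop :=
  IsMixedDeriv f m ∧ SuppIn m K2 ∧ (∀ x ∉ K2, f x = 0) ∧
  (∀ᵐ x : ℝ × ℝ, f x = m (Icc 0 x.1 ×ˢ Icc 0 x.2))

def Nmix (θ : ℝ) (m ν₁ ν₂ : SignedMeasure (ℝ × ℝ)) : ℝ :=
  θ * TV m + (1 - θ) * (TV ν₁ + TV ν₂)

def ind (A : Set (ℝ × ℝ)) : ℝ × ℝ → ℝ := A.indicator (fun _ => 1)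

lemma real_univ_sub_le_integral (μ : Measure (ℝ × ℝ)) [IsFiniteMeasure μ] {φ : ℝ × ℝ → ℝ}
    (hφ : Continuous φ) (hb : ∀ x, |φ x| ≤ 1) {K : Set (ℝ × ℝ)} (hK : MeasurableSet K)
    (h1 : ∀ x ∈ K, φ x = 1) : μ.real univ - 2 * μ.real Kᶜ ≤ ∫ x, φ x ∂μ := by
  have hint : Integrable φ μ :=
    Integrable.of_bound hφ.aestronglyMeasurable 1 (ae_of_all _ fun x => by simpa using hb x)
  have hi : Integrable (Kᶜ.indicator fun _ => (2 : ℝ)) μ :=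
    (integrable_const _).indicator hK.compl
  have hle : ∫ x, ((1 : ℝ) - Kᶜ.indicator (fun _ => (2 : ℝ)) x) ∂μ ≤ ∫ x, φ x ∂μ := by
    refine integral_mono ((integrable_const _).sub hi) hint fun x => ?_
    by_cases hx : x ∈ K
    · simp [hx, h1 x hx]
    · have := (abs_le.1 (hb x)).1
      simp only [indicator_of_mem (mem_compl hx)]
      linarith
  rw [integral_sub (integrable_const _) hi, integral_indicator_const _ hK.compl] at hle
  simp only [integral_const, smul_eq_mul, mul_one] at hle
  linarith

lemma exists_isTest_eq_one_neg_one {K L : Set (ℝ × ℝ)} (hK : IsCompact K) (hL : IsCompact L)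
    (hd : Disjoint K L) :
    ∃ φ, IsTest φ ∧ (∀ x, |φ x| ≤ 1) ∧ (∀ x ∈ K, φ x = 1) ∧ ∀ x ∈ L, φ x = -1 := by
  obtain ⟨η, hη, hηr, hη0, hη1⟩ := exists_contMDiff_zero_iff_one_iff_of_isClosed
    (n := (⊤ : ℕ∞)) (modelWithCornersSelf ℝ (ℝ × ℝ)) hL.isClosed hK.isClosed hd.symm
  obtain ⟨R, hR⟩ := (hK.union hL).isBounded.subset_ball 0
  obtain ⟨χ, hχ, hχr, hχs, hχ1⟩ := exists_contMDiff_support_eq_eq_one_iff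
    (n := (⊤ : ℕ∞)) (modelWithCornersSelf ℝ (ℝ × ℝ)) Metric.isOpen_ball
    (hK.union hL).isClosed hR
  rw [contMDiff_iff_contDiff] at hη hχ
  have hχc : HasCompactSupport χ := by
    refine HasCompactSupport.intro (isCompact_closedBall (0 : ℝ × ℝ) R) fun x hx => ?_
    by_contra h
    have : x ∈ Function.support χ := h
    rw [hχs] at this
    exact hx (Metric.ball_subset_closedBall this)
  refine ⟨fun x => χ x * (2 * η x - 1),
    ⟨hχ.mul ((contDiff_const.mul hη).sub contDiff_const), hχc.mul_right⟩,
    fun x => ?_, fun x hx => ?_, fun x hx => ?_⟩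
  · obtain ⟨h1, h2⟩ := hηr (mem_range_self x)
    obtain ⟨h3, h4⟩ := hχr (mem_range_self x)
    rw [abs_mul]
    refine mul_le_one₀ (abs_le.2 ⟨by linarith, h4⟩) (abs_nonneg _)
      (abs_le.2 ⟨by linarith, by linarith⟩)
  · simp only [(hη1 x).1 hx, (hχ1 x).1 (Or.inl hx)]; norm_num
  · simp only [(hη0 x).1 hx, (hχ1 x).1 (Or.inr hx)]; norm_num

lemma exists_isCompact_real_compl_lt (μ : Measure (ℝ × ℝ)) [IsFiniteMeasure μ]
    {s : Set (ℝ × ℝ)} (hs : MeasurableSet s) (h0 : μ sᶜ = 0) {δ : ℝ} (hδ : 0 < δ) :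
    ∃ K ⊆ s, IsCompact K ∧ μ.real Kᶜ < δ := by
  obtain ⟨K, hKs, hK, hlt⟩ := hs.exists_isCompact_sdiff_lt (measure_ne_top μ s)
    (ENNReal.ofReal_pos.2 hδ).ne'
  refine ⟨K, hKs, hK, ?_⟩
  have hle : μ Kᶜ ≤ μ (s \ K) := by
    calc μ Kᶜ ≤ μ (sᶜ ∪ s \ K) := measure_mono fun x hx => by
          by_cases h : x ∈ s
          · exact Or.inr ⟨h, hx⟩
          · exact Or.inl h
      _ ≤ μ sᶜ + μ (s \ K) := measure_union_le _ _
      _ = μ (s \ K) := by rw [h0, zero_add]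
  exact (ENNReal.lt_ofReal_iff_toReal_lt (measure_ne_top _ _)).1 (hle.trans_lt hlt)

lemma TV_eq (m : SignedMeasure (ℝ × ℝ)) :
    TV m = m.toJordanDecomposition.posPart.real univ +
      m.toJordanDecomposition.negPart.real univ := by
  simp only [TV, SignedMeasure.totalVariation, Measure.add_apply, Measure.real]
  exact ENNReal.toReal_add (measure_ne_top _ _) (measure_ne_top _ _)

lemma TV_nonneg (m : SignedMeasure (ℝ × ℝ)) : 0 ≤ TV m := ENNReal.toReal_nonneg

lemma TV_le_of_forall_sInt_le (ν : SignedMeasure (ℝ × ℝ)) (c : ℝ)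
    (h : ∀ φ, IsTest φ → (∀ x, |φ x| ≤ 1) → sInt ν φ ≤ c) : TV ν ≤ c := by
  refine le_of_forall_pos_le_add fun ε hε => ?_
  obtain ⟨s, hs, hp, hn⟩ := ν.toJordanDecomposition.mutuallySingular
  obtain ⟨K, hKs, hK, hKlt⟩ := exists_isCompact_real_compl_lt _ hs.compl
    (by rwa [compl_compl]) (show 0 < ε / 4 by positivity)
  obtain ⟨L, hLs, hL, hLlt⟩ := exists_isCompact_real_compl_lt _ hs hn
    (show 0 < ε / 4 by positivity)
  obtain ⟨φ, hφ, hb, h1, h2⟩ := exists_isTest_eq_one_neg_one hK hL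
    (disjoint_compl_left.mono hKs hLs)
  have hpos := real_univ_sub_le_integral ν.toJordanDecomposition.posPart
    hφ.1.continuous hb hK.measurableSet h1
  have hneg := real_univ_sub_le_integral ν.toJordanDecomposition.negPart
    hφ.1.continuous.neg (by simpa using hb) hL.measurableSet (fun x hx => by simp [h2 x hx])
  rw [integral_neg'] at hneg
  have := h φ hφ hb
  rw [TV_eq]
  unfold sInt at this
  linarith

lemma integral_Ici_pd1 {φ : ℝ × ℝ → ℝ} (hφ : ContDiff ℝ 1 φ) (hc : HasCompactSupport φ)
    (a t : ℝ) : ∫ s in Ici a, pd1 φ (s, t) = -φ (a, t) := by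
  have hder : ∀ s, HasDerivAt (fun s => φ (s, t)) (pd1 φ (s, t)) s := fun s =>
    ((hφ.differentiable one_ne_zero (s, t)).hasFDerivAt).comp_hasDerivAt s
      ((hasDerivAt_id s).prodMk (hasDerivAt_const s t))
  have hcomp : HasCompactSupport fun s => φ (s, t) :=
    hc.comp_isClosedEmbedding (Topology.IsClosedEmbedding.of_continuous_injective_isClosedMap
      (by fun_prop) (fun _ _ h => congrArg Prod.fst h) (isClosedMap_prodMk_right t))
  have hC : ContDiff ℝ 1 fun s => φ (s, t) := hφ.comp (contDiff_id.prodMk contDiff_const)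
  rw [integral_Ici_eq_integral_Ioi, ← hcomp.integral_Ioi_deriv_eq hC]
  simp only [(hder _).deriv]

lemma continuous_pd1 {φ : ℝ × ℝ → ℝ} (hφ : ContDiff ℝ 1 φ) : Continuous (pd1 φ) :=
  (hφ.continuous_fderiv one_ne_zero).clm_apply continuous_const

lemma integrable_pd1 {φ : ℝ × ℝ → ℝ} (hφ : ContDiff ℝ 1 φ) (hc : HasCompactSupport φ) :
    Integrable (pd1 φ) :=
  (continuous_pd1 hφ).integrable_of_hasCompactSupport (hc.fderiv_apply ℝ _)

lemma abs_setIntegral_pd1_le {φ : ℝ × ℝ → ℝ} (hφ : ContDiff ℝ 1 φ) (hc : HasCompactSupport φ)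
    (hb : ∀ x, |φ x| ≤ 1) (a : ℝ) {b : ℝ} (hb0 : 0 ≤ b) :
    |∫ x in Ici a ×ˢ Icc b 1, pd1 φ x| ≤ 1 := by
  have hint := (integrable_pd1 hφ hc).integrableOn (s := Ici a ×ˢ Icc b 1)
  rw [Measure.volume_eq_prod] at hint ⊢
  rw [← Measure.prod_restrict, integral_prod_symm _ (by rwa [Measure.prod_restrict])]
  simp only [integral_Ici_pd1 hφ hc]
  refine (norm_setIntegral_le_of_norm_le_const (μ := volume) (s := Icc b 1) (C := 1)
    (f := fun t => -φ (a, t)) measure_Icc_lt_top fun t _ => ?_).trans ?_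
  · simpa using hb (a, t)
  · simp only [Measure.real, Real.volume_Icc, one_mul]
    exact ENNReal.toReal_le_of_le_ofReal zero_le_one (ENNReal.ofReal_le_ofReal (by linarith))

/-- Pairs `(x, y)` with `x.2 ≤ 1` and `y` in the rectangle `[0, x.1] × [0, x.2]`. -/
def cornerSet : Set ((ℝ × ℝ) × (ℝ × ℝ)) :=
  {z | z.1.2 ≤ 1 ∧ z.2 ∈ Icc 0 z.1.1 ×ˢ Icc 0 z.1.2}

lemma measurableSet_cornerSet : MeasurableSet cornerSet := by
  have : cornerSet = {z | z.1.2 ≤ 1} ∩ ({z | 0 ≤ z.2.1} ∩ {z | z.2.1 ≤ z.1.1}) ∩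
      ({z | 0 ≤ z.2.2} ∩ {z | z.2.2 ≤ z.1.2}) := by
    ext z; simp only [cornerSet, mem_ofPred_eq, mem_inter_iff, mem_prod, mem_Icc]; tauto
  rw [this]
  refine ((measurableSet_le (by fun_prop) (by fun_prop)).inter
    ((measurableSet_le (by fun_prop) (by fun_prop)).inter
      (measurableSet_le (by fun_prop) (by fun_prop)))).inter
    ((measurableSet_le (by fun_prop) (by fun_prop)).inter
      (measurableSet_le (by fun_prop) (by fun_prop)))

/-- The distribution function of `μ` on the positive quadrant, cut off at height `1`. -/
def cutDistrib (μ : Measure (ℝ × ℝ)) (x : ℝ × ℝ) : ℝ :=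
  if x.2 ≤ 1 then μ.real (Icc 0 x.1 ×ˢ Icc 0 x.2) else 0

section

variable (μ : Measure (ℝ × ℝ)) {φ : ℝ × ℝ → ℝ}

lemma integral_cornerSet_indicator (x : ℝ × ℝ) :
    ∫ y, cornerSet.indicator (fun z => pd1 φ z.1) (x, y) ∂μ = cutDistrib μ x * pd1 φ x := by
  by_cases hx : x.2 ≤ 1
  · have : (fun y => cornerSet.indicator (fun z => pd1 φ z.1) (x, y)) =
        (Icc 0 x.1 ×ˢ Icc 0 x.2).indicator fun _ => pd1 φ x := by
      ext y; simp only [indicator, cornerSet, mem_ofPred_eq, hx, true_and]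
    rw [this, integral_indicator_const _ (measurableSet_Icc.prod measurableSet_Icc)]
    simp [cutDistrib, hx]
  · simp [cutDistrib, hx, cornerSet, indicator]

variable [IsFiniteMeasure μ]

lemma integrable_cornerSet_indicator (hφ : ContDiff ℝ 1 φ) (hc : HasCompactSupport φ) :
    Integrable (cornerSet.indicator fun z => pd1 φ z.1)
      ((volume : Measure (ℝ × ℝ)).prod μ) :=
  ((integrable_pd1 hφ hc).comp_fst μ).indicator measurableSet_cornerSet

lemma integrable_cutDistrib_mul_pd1 (hφ : ContDiff ℝ 1 φ) (hc : HasCompactSupport φ) :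
    Integrable fun x => cutDistrib μ x * pd1 φ x := by
  simpa only [integral_cornerSet_indicator] using
    (integrable_cornerSet_indicator μ hφ hc).integral_prod_left

lemma abs_integral_cutDistrib_mul_pd1_le (hφ : ContDiff ℝ 1 φ) (hc : HasCompactSupport φ)
    (hb : ∀ x, |φ x| ≤ 1) : |∫ x, cutDistrib μ x * pd1 φ x| ≤ μ.real univ := by
  have hinner : ∀ y : ℝ × ℝ,
      ‖∫ x, cornerSet.indicator (fun z => pd1 φ z.1) (x, y)‖ ≤ 1 := by
    intro y
    by_cases hy : 0 ≤ y.1 ∧ 0 ≤ y.2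
    · have : (fun x => cornerSet.indicator (fun z => pd1 φ z.1) (x, y)) =
          (Ici y.1 ×ˢ Icc y.2 1).indicator (pd1 φ) := by
        ext x
        refine indicator_eq_indicator ?_ rfl
        simp only [cornerSet, mem_ofPred_eq, mem_prod, mem_Icc, mem_Ici, hy.1, hy.2, true_and]
        tauto
      rw [this, integral_indicator (measurableSet_Ici.prod measurableSet_Icc)]
      exact abs_setIntegral_pd1_le hφ hc hb _ hy.2
    · have : (fun x => cornerSet.indicator (fun z => pd1 φ z.1) (x, y)) = 0 := by
        ext x
        refine indicator_of_notMem (fun h => hy ?_) _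
        exact ⟨h.2.1.1, h.2.2.1⟩
      simp [this]
  simp only [← integral_cornerSet_indicator]
  rw [integral_integral_swap (f := fun x y => cornerSet.indicator (fun z => pd1 φ z.1) (x, y))
    (integrable_cornerSet_indicator μ hφ hc)]
  simpa using norm_integral_le_of_norm_le_const (ae_of_all μ hinner)

end

lemma signedMeasure_apply_eq (m : SignedMeasure (ℝ × ℝ)) {s : Set (ℝ × ℝ)}
    (hs : MeasurableSet s) :
    m s = m.toJordanDecomposition.posPart.real s - m.toJordanDecomposition.negPart.real s := by
  conv_lhs => rw [← m.toSignedMeasure_toJordanDecomposition]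
  simp [JordanDecomposition.toSignedMeasure, Measure.toSignedMeasure_apply_measurable hs]

/-- If `g` is a.e. the difference of two cut-off distribution functions, its weak first partial
derivative has total variation at most the total mass. -/
lemma abs_integral_mul_pd1_le (p n : Measure (ℝ × ℝ)) [IsFiniteMeasure p] [IsFiniteMeasure n]
    {g φ : ℝ × ℝ → ℝ} (hg : ∀ᵐ x, g x = cutDistrib p x - cutDistrib n x)
    (hφ : ContDiff ℝ 1 φ) (hc : HasCompactSupport φ) (hb : ∀ x, |φ x| ≤ 1) :
    |∫ x, g x * pd1 φ x| ≤ p.real univ + n.real univ := by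
  have : ∫ x, g x * pd1 φ x =
      (∫ x, cutDistrib p x * pd1 φ x) - ∫ x, cutDistrib n x * pd1 φ x := by
    rw [← integral_sub (integrable_cutDistrib_mul_pd1 p hφ hc)
      (integrable_cutDistrib_mul_pd1 n hφ hc)]
    refine integral_congr_ae (hg.mono fun x hx => ?_)
    simp only [hx, sub_mul]
  rw [this]
  exact (abs_sub _ _).trans (add_le_add (abs_integral_cutDistrib_mul_pd1_le p hφ hc hb)
    (abs_integral_cutDistrib_mul_pd1_le n hφ hc hb))

variable {f : ℝ × ℝ → ℝ} {m ν : SignedMeasure (ℝ × ℝ)}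

lemma MemM0.TV_le_of_isDeriv1 (hf : MemM0 f m) (hν : IsDeriv1 f ν) : TV ν ≤ TV m := by
  refine TV_le_of_forall_sInt_le ν _ fun φ hφ hb => ?_
  have hg : ∀ᵐ x, f x = cutDistrib m.toJordanDecomposition.posPart x -
      cutDistrib m.toJordanDecomposition.negPart x := by
    filter_upwards [hf.2.2.2] with x hx
    by_cases h : x.2 ≤ 1
    · rw [hx, signedMeasure_apply_eq m (measurableSet_Icc.prod measurableSet_Icc)]
      simp [cutDistrib, h]
    · rw [hf.2.2.1 x fun h' => h h'.2.2]
      simp [cutDistrib, h]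
  have := abs_integral_mul_pd1_le _ _ hg (hφ.1.of_le (by exact_mod_cast le_top)) hφ.2 hb
  rw [hν φ hφ, abs_neg, ← TV_eq] at this
  exact (le_abs_self _).trans this

lemma pd1_comp_swap {φ : ℝ × ℝ → ℝ} (hφ : ContDiff ℝ 1 φ) (x : ℝ × ℝ) :
    pd1 (fun x => φ x.swap) x = pd2 φ x.swap := by
  have h := ((hφ.differentiable one_ne_zero x.swap).hasFDerivAt).comp x
    (ContinuousLinearEquiv.prodComm ℝ ℝ ℝ).toContinuousLinearMap.hasFDerivAt
  have h' : HasFDerivAt (fun x : ℝ × ℝ => φ x.swap) _ x := h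
  rw [pd1, h'.fderiv]
  simp [pd2]

lemma MemM0.TV_le_of_isDeriv2 (hf : MemM0 f m) (hν : IsDeriv2 f ν) : TV ν ≤ TV m := by
  refine TV_le_of_forall_sInt_le ν _ fun φ hφ hb => ?_
  have hφ1 : ContDiff ℝ 1 φ := hφ.1.of_le (by exact_mod_cast le_top)
  have hswap : MeasurePreserving (Prod.swap : ℝ × ℝ → ℝ × ℝ) := Measure.measurePreserving_swap
  have hg : ∀ᵐ x : ℝ × ℝ, f x.swap =
      cutDistrib (m.toJordanDecomposition.posPart.map Prod.swap) x -
      cutDistrib (m.toJordanDecomposition.negPart.map Prod.swap) x := by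
    filter_upwards [hswap.quasiMeasurePreserving.ae hf.2.2.2] with x hx
    by_cases h : x.2 ≤ 1
    · rw [hx, signedMeasure_apply_eq m (measurableSet_Icc.prod measurableSet_Icc)]
      simp only [cutDistrib, if_pos h, map_measureReal_apply measurable_swap
        (measurableSet_Icc.prod measurableSet_Icc), preimage_swap_prod, Prod.fst_swap,
        Prod.snd_swap]
    · rw [hf.2.2.1 x.swap fun h' => h h'.1.2]
      simp [cutDistrib, h]
  have := abs_integral_mul_pd1_le _ _ hg (φ := fun x => φ x.swap)
    (hφ1.comp (contDiff_snd.prodMk contDiff_fst))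
    (hφ.2.comp_homeomorph (Homeomorph.prodComm ℝ ℝ)) fun x => hb _
  simp only [pd1_comp_swap hφ1] at this
  rw [hswap.integral_comp (MeasurableEquiv.prodComm (α := ℝ) (β := ℝ)).measurableEmbedding
      fun x => f x * pd2 φ x, hν φ hφ, abs_neg,
    map_measureReal_apply measurable_swap .univ, map_measureReal_apply measurable_swap .univ,
    preimage_univ, ← TV_eq] at this
  exact (le_abs_self _).trans this

theorem stmt1 (θ θ' : ℝ) (hθ : θ ∈ Ioc (0:ℝ) 1) (hθ' : θ' ∈ Ioc (0:ℝ) 1) :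
    ∃ C : ℝ, 0 < C ∧
      ∀ (f : ℝ × ℝ → ℝ) (m ν₁ ν₂ : SignedMeasure (ℝ × ℝ)),
        MemM0 f m → IsDeriv1 f ν₁ → IsDeriv2 f ν₂ →
        Nmix θ m ν₁ ν₂ ≤ C * Nmix θ' m ν₁ ν₂ := by
  obtain ⟨h0, h1⟩ := hθ
  obtain ⟨h0', h1'⟩ := hθ'
  refine ⟨2 / θ', by positivity, fun f m ν₁ ν₂ hf hν₁ hν₂ => ?_⟩
  have ha := hf.TV_le_of_isDeriv1 hν₁
  have hb := hf.TV_le_of_isDeriv2 hν₂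
  have hm := TV_nonneg m
  calc Nmix θ m ν₁ ν₂ ≤ θ * TV m + (1 - θ) * (TV m + TV m) := by
        unfold Nmix
        gcongr
    _ ≤ 2 * TV m := by nlinarith
    _ = 2 / θ' * (θ' * TV m) := by field_simp
    _ ≤ 2 / θ' * Nmix θ' m ν₁ ν₂ := by
        unfold Nmix
        gcongr
        exact le_add_of_nonneg_right (mul_nonneg (by linarith)
          (add_nonneg (TV_nonneg _) (TV_nonneg _)))
end
end

section
/- If 𝟙_A ∈ M_{D⊗D,0}(K), then the mixed derivative (D⊗D)𝟙_A is a finite discrete measure with finitely many atoms, each of amplitude ±1, and one has the representation 𝟙_A(t1,t2) = Σ_{k=1}^K a_k u(t1 − x_{1,k}) u(t2 − x_{2,k}) with a_k ∈ {−1, 1} and (x_{1,k}, x_{2,k}) ∈ K. -/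
open MeasureTheory Set Filter
open scoped Classical

noncomputable section

def heav (t : ℝ) : ℝ := if 0 ≤ t then 1 else 0

/-- A finite signed measure with integer values on a generating π-system and on the whole space
takes only integer values. -/
lemma signedMeasure_mem_range_intCast_of_piSystem {α : Type*} [mα : MeasurableSpace α]
    (m : SignedMeasure α) {C : Set (Set α)} (hC : mα = MeasurableSpace.generateFrom C)
    (hpi : IsPiSystem C) (huniv : m univ ∈ range ((↑) : ℤ → ℝ))
    (hint : ∀ B ∈ C, m B ∈ range ((↑) : ℤ → ℝ)) {B : Set α} (hB : MeasurableSet B) :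
    m B ∈ range ((↑) : ℤ → ℝ) := by
  induction B, hB using MeasurableSpace.induction_on_inter hC hpi with
  | empty => exact ⟨0, by simp⟩
  | basic t ht => exact hint t ht
  | compl t ht ih =>
    obtain ⟨a, ha⟩ := huniv
    obtain ⟨b, hb⟩ := ih
    have h := VectorMeasure.of_add_of_sdiff (v := m) ht MeasurableSet.univ (subset_univ t)
    rw [← compl_eq_univ_sdiff] at h
    exact ⟨a - b, by push_cast; linarith⟩
  | iUnion f hd hf ih =>
    choose k hk using ih
    refine Int.isClosedEmbedding_coe_real.isClosed_range.mem_of_tendsto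
      (m.hasSum_of_disjoint_iUnion hf hd) (Eventually.of_forall fun s => ⟨∑ i ∈ s, k i, ?_⟩)
    push_cast
    exact Finset.sum_congr rfl fun i _ => hk i

lemma SignedMeasure.apply_eq_posPart_sub_negPart {α : Type*} [MeasurableSpace α]
    (m : SignedMeasure α) {B : Set α} (hB : MeasurableSet B) :
    m B = m.toJordanDecomposition.posPart.real B - m.toJordanDecomposition.negPart.real B := by
  conv_lhs => rw [← m.toSignedMeasure_toJordanDecomposition]
  rw [JordanDecomposition.toSignedMeasure, Measure.toSignedMeasure_sub_apply hB]

lemma exists_natCast_eq_measure {α : Type*} [MeasurableSpace α] (μ : Measure α)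
    [IsFiniteMeasure μ] {B : Set α} (h : μ.real B ∈ range ((↑) : ℤ → ℝ)) :
    ∃ n : ℕ, μ B = n := by
  obtain ⟨k, hk⟩ := h
  have hk0 : 0 ≤ k := by
    have : (0 : ℝ) ≤ k := hk ▸ measureReal_nonneg
    exact_mod_cast this
  lift k to ℕ using hk0
  refine ⟨k, ?_⟩
  rw [← ENNReal.ofReal_toReal (measure_ne_top μ B), ← measureReal_def, ← hk]
  simp

/-- A finite measure taking only integer values is a finite sum of Dirac masses. -/
lemma exists_list_measure_eq_countP (N : ℕ) : ∀ μ : Measure (ℝ × ℝ), μ univ = N →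
    (∀ B, MeasurableSet B → ∃ n : ℕ, μ B = n) →
    ∃ l : List (ℝ × ℝ), ∀ B, MeasurableSet B → μ B = (l.countP (· ∈ B) : ℕ) := by
  induction N using Nat.strong_induction_on with
  | _ N ih =>
  intro μ hN hμ
  have : IsFiniteMeasure μ := ⟨by rw [hN]; exact ENNReal.natCast_lt_top N⟩
  by_cases hatom : ∃ x, μ {x} ≠ 0
  · obtain ⟨x, hx⟩ := hatom
    obtain ⟨k, hk⟩ := hμ {x} (measurableSet_singleton x)
    obtain ⟨j, hj⟩ := hμ {x}ᶜ (measurableSet_singleton x).compl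
    have hjk : k + j = N := by
      have := measure_add_measure_compl (μ := μ) (measurableSet_singleton x)
      rw [hk, hj, hN] at this
      exact_mod_cast this
    have hk0 : k ≠ 0 := by rintro rfl; simp [hk] at hx
    obtain ⟨l, hl⟩ := ih j (by omega) (μ.restrict {x}ᶜ) (by simp [hj]) (fun B hB => by
      rw [Measure.restrict_apply hB]
      exact hμ _ (hB.inter (measurableSet_singleton x).compl))
    refine ⟨List.replicate k x ++ l, fun B hB => ?_⟩
    rw [← measure_inter_add_sdiff B (measurableSet_singleton x), sdiff_eq,
      ← Measure.restrict_apply (t := B) (s := {x}ᶜ) hB, hl B hB, List.countP_append, List.countP_replicate]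
    by_cases hxB : x ∈ B
    · rw [inter_eq_right.mpr (singleton_subset_iff.mpr hxB), hk]
      simp [hxB]
    · rw [inter_singleton_eq_empty.mpr hxB]
      simp [hxB]
  · push Not at hatom
    have hzero : μ univ = 0 := by
      refine measure_null_of_locally_null univ fun x _ => ?_
      obtain ⟨U, hxU, hUo, hU⟩ := Set.exists_isOpen_lt_of_lt (μ := μ) {x} 1 (by simp [hatom x])
      refine ⟨U, by simpa using hUo.mem_nhds (hxU rfl), ?_⟩
      obtain ⟨n, hn⟩ := hμ U hUo.measurableSet
      rw [hn] at hU ⊢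
      have : n < 1 := by exact_mod_cast hU
      simp; omega
    exact ⟨[], fun B _ => by simpa using measure_mono_null (subset_univ B) hzero⟩

/-- A finite signed measure on the plane with integer values is a signed sum of Dirac masses. -/
lemma exists_lists_signedMeasure_eq (m : SignedMeasure (ℝ × ℝ))
    (hm : ∀ B, MeasurableSet B → m B ∈ range ((↑) : ℤ → ℝ)) {S : Set (ℝ × ℝ)}
    (hS : MeasurableSet S) (hsupp : SuppIn m S) :
    ∃ p q : List (ℝ × ℝ), (∀ x ∈ p, x ∈ S) ∧ (∀ x ∈ q, x ∈ S) ∧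
      ∀ B, MeasurableSet B → m B = p.countP (· ∈ B) - q.countP (· ∈ B) := by
  obtain ⟨i, hi, hi₂, hi₃, hpos, hneg⟩ := m.toJordanDecomposition_spec
  have key : ∀ μ : Measure (ℝ × ℝ), IsFiniteMeasure μ → μ Sᶜ = 0 →
      (∀ B, MeasurableSet B → μ.real B ∈ range ((↑) : ℤ → ℝ)) →
      ∃ l : List (ℝ × ℝ), (∀ x ∈ l, x ∈ S) ∧
        ∀ B, MeasurableSet B → μ.real B = l.countP (· ∈ B) := by
    intro μ _ hμS hμ
    obtain ⟨N, hN⟩ := exists_natCast_eq_measure μ (hμ univ .univ)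
    obtain ⟨l, hl⟩ := exists_list_measure_eq_countP N μ hN
      fun B hB => exists_natCast_eq_measure μ (hμ B hB)
    refine ⟨l, fun x hx => ?_, fun B hB => by simp [measureReal_def, hl B hB]⟩
    have h0 := hl Sᶜ hS.compl
    rw [hμS, eq_comm, Nat.cast_eq_zero, List.countP_eq_zero] at h0
    simpa using h0 x hx
  rw [SuppIn, SignedMeasure.totalVariation, Measure.coe_add, Pi.add_apply, add_eq_zero] at hsupp
  obtain ⟨p, hpS, hp⟩ := key _ inferInstance hsupp.1 fun B hB => by
    rw [hpos, SignedMeasure.toMeasureOfZeroLE_real_apply _ hi₂ hi hB]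
    exact hm _ (hi.inter hB)
  obtain ⟨q, hqS, hq⟩ := key _ inferInstance hsupp.2 fun B hB => by
    rw [hneg, SignedMeasure.toMeasureOfLEZero_real_apply _ hi₃ hi.compl hB]
    obtain ⟨k, hk⟩ := hm _ (hi.compl.inter hB)
    exact ⟨-k, by push_cast; rw [hk]⟩
  exact ⟨p, q, hpS, hqS, fun B hB => by
    rw [SignedMeasure.apply_eq_posPart_sub_negPart m hB, hp B hB, hq B hB]⟩

/-- The distribution function of a finite signed measure is continuous from the upper right. -/
lemma tendsto_signedMeasure_Iic_prod_Iic (m : SignedMeasure (ℝ × ℝ)) (t : ℝ × ℝ) :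
    Tendsto (fun u : ℝ × ℝ => m (Iic u.1 ×ˢ Iic u.2))
      (nhdsWithin t (Ioi t.1 ×ˢ Ioi t.2)) (nhds (m (Iic t.1 ×ˢ Iic t.2))) := by
  have hmeas : ∀ u : ℝ × ℝ, MeasurableSet (Iic u.1 ×ˢ Iic u.2) := fun u =>
    measurableSet_Iic.prod measurableSet_Iic
  have hmem : ∀ x : ℝ × ℝ, ∀ᶠ u in nhdsWithin t (Ioi t.1 ×ˢ Ioi t.2),
      x ∈ Iic u.1 ×ˢ Iic u.2 ↔ x ∈ Iic t.1 ×ˢ Iic t.2 := by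
    intro x
    by_cases hx : x.1 ≤ t.1 ∧ x.2 ≤ t.2
    · filter_upwards [self_mem_nhdsWithin] with u hu
      have hu₁ : t.1 < u.1 := hu.1
      have hu₂ : t.2 < u.2 := hu.2
      exact iff_of_true ⟨hx.1.trans hu₁.le, hx.2.trans hu₂.le⟩ hx
    · have hlt : t.1 < x.1 ∨ t.2 < x.2 := by
        by_contra! h
        exact hx h
      have hout : ∀ᶠ u in nhds t, ¬ (x.1 ≤ u.1 ∧ x.2 ≤ u.2) := by
        rcases hlt with h | h
        · filter_upwards [continuous_fst.continuousAt.eventually_lt_const h] with u hu hc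
          exact absurd hc.1 (not_le.mpr hu)
        · filter_upwards [continuous_snd.continuousAt.eventually_lt_const h] with u hu hc
          exact absurd hc.2 (not_le.mpr hu)
      filter_upwards [nhdsWithin_le_nhds hout] with u hu
      exact iff_of_false hu hx
  have hreal : ∀ μ : Measure (ℝ × ℝ), IsFiniteMeasure μ →
      Tendsto (fun u : ℝ × ℝ => μ.real (Iic u.1 ×ˢ Iic u.2))
        (nhdsWithin t (Ioi t.1 ×ˢ Ioi t.2)) (nhds (μ.real (Iic t.1 ×ˢ Iic t.2))) := fun μ _ =>
    (ENNReal.tendsto_toReal (measure_ne_top μ _)).comp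
      (tendsto_measure_of_tendsto_indicator_of_isFiniteMeasure _ μ hmeas hmem)
  simp_rw [fun u => SignedMeasure.apply_eq_posPart_sub_negPart m (hmeas u)]
  exact (hreal _ inferInstance).sub (hreal _ inferInstance)

/-- A property holding almost everywhere holds at points arbitrarily close to the upper right
of any given point. -/
lemma frequently_nhdsWithin_Ioi_prod_Ioi_of_ae {P : ℝ × ℝ → Prop} (hP : ∀ᵐ x : ℝ × ℝ, P x)
    (t : ℝ × ℝ) : ∃ᶠ x in nhdsWithin t (Ioi t.1 ×ˢ Ioi t.2), P x := by
  intro hnot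
  obtain ⟨V, hV, htV, hsub⟩ := mem_nhdsWithin.mp hnot
  have hnull : volume (V ∩ Ioi t.1 ×ˢ Ioi t.2) = 0 :=
    measure_mono_null (fun x hx => hsub hx) (ae_iff.mp hP)
  have hempty := (hV.inter (isOpen_Ioi.prod isOpen_Ioi)).measure_eq_zero_iff volume |>.mp hnull
  have hcl : t ∈ closure (Ioi t.1 ×ˢ Ioi t.2) := by
    rw [closure_prod_eq, closure_Ioi, closure_Ioi]
    exact ⟨self_mem_Ici, self_mem_Ici⟩
  exact (mem_closure_iff.mp hcl V hV htV).ne_empty hempty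

/-- A signed measure supported in `S` only sees the part of a set inside `S`. -/
lemma SuppIn.apply_inter {m : SignedMeasure (ℝ × ℝ)} {S B : Set (ℝ × ℝ)} (h : SuppIn m S)
    (hS : MeasurableSet S) (hB : MeasurableSet B) : m (B ∩ S) = m B := by
  have hzero : m (B \ (B ∩ S)) = 0 :=
    m.null_of_totalVariation_zero (measure_mono_null (fun x hx hxS => hx.2 ⟨hx.1, hxS⟩) h)
  have := VectorMeasure.of_add_of_sdiff (v := m) (hB.inter hS) hB inter_subset_left
  rwa [hzero, add_zero] at this

lemma measurableSpace_prod_eq_generateFrom_Iic :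
    (inferInstance : MeasurableSpace (ℝ × ℝ)) =
      MeasurableSpace.generateFrom (image2 (· ×ˢ ·) (range Iic) (range Iic)) := by
  have hspan : IsCountablySpanning (range (Iic : ℝ → Set ℝ)) := by
    refine ⟨fun n : ℕ => Iic (n : ℝ), fun n => mem_range_self _, ?_⟩
    exact eq_univ_of_forall fun x => mem_iUnion.mpr (exists_nat_ge x)
  have hborel : (inferInstance : MeasurableSpace ℝ) =
      MeasurableSpace.generateFrom (range Iic) :=
    (BorelSpace.measurable_eq (α := ℝ)).trans (borel_eq_generateFrom_Iic ℝ)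
  rw [← generateFrom_prod_eq hspan hspan, ← hborel]

lemma mem_range_intCast_of_memM0_ind {A : Set (ℝ × ℝ)} {m : SignedMeasure (ℝ × ℝ)}
    (hm : MemM0 (ind A) m) {B : Set (ℝ × ℝ)} (hB : MeasurableSet B) :
    m B ∈ range ((↑) : ℤ → ℝ) := by
  obtain ⟨-, hsupp, -, hrep⟩ := hm
  have hK : MeasurableSet K2 := measurableSet_Icc.prod measurableSet_Icc
  have hIic : ∀ u : ℝ × ℝ, MeasurableSet (Iic u.1 ×ˢ Iic u.2) := fun u =>
    measurableSet_Iic.prod measurableSet_Iic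
  have hquad : ∀ u : ℝ × ℝ, m (Icc 0 u.1 ×ˢ Icc 0 u.2) = m (Iic u.1 ×ˢ Iic u.2) := by
    intro u
    rw [← hsupp.apply_inter hK (hIic u),
      ← hsupp.apply_inter hK (measurableSet_Icc.prod measurableSet_Icc)]
    congr 1
    ext x
    simp only [mem_inter_iff, mem_prod, mem_Icc, mem_Iic]
    tauto
  have hae : ∀ᵐ u : ℝ × ℝ, m (Iic u.1 ×ˢ Iic u.2) ∈ range ((↑) : ℤ → ℝ) := by
    filter_upwards [hrep] with u hu
    rw [← hquad, ← hu]
    by_cases huA : u ∈ A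
    · exact ⟨1, by simp [ind, huA]⟩
    · exact ⟨0, by simp [ind, huA]⟩
  have hall : ∀ t : ℝ × ℝ, m (Iic t.1 ×ˢ Iic t.2) ∈ range ((↑) : ℤ → ℝ) := fun t =>
    Int.isClosedEmbedding_coe_real.isClosed_range.mem_of_frequently_of_tendsto
      (frequently_nhdsWithin_Ioi_prod_Ioi_of_ae hae t) (tendsto_signedMeasure_Iic_prod_Iic m t)
  refine signedMeasure_mem_range_intCast_of_piSystem m measurableSpace_prod_eq_generateFrom_Iic
    (isPiSystem_Iic.prod isPiSystem_Iic) ?_ ?_ hB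
  · have huniv : m univ = m (Iic (1 : ℝ) ×ˢ Iic (1 : ℝ)) := by
      rw [← hsupp.apply_inter hK .univ, ← hsupp.apply_inter hK (hIic (1, 1))]
      congr 1
      ext x
      simp only [mem_inter_iff, mem_prod, mem_Icc, mem_Iic, mem_univ]
      tauto
    exact huniv ▸ hall (1, 1)
  · rintro _ ⟨_, ⟨a, rfl⟩, _, ⟨b, rfl⟩, rfl⟩
    exact hall (a, b)

lemma List.sum_map_const_mul_ite_mem_eq_countP {α : Type*} (c : ℝ) (l : List α) (B : Set α) :
    (l.map fun x => c * (if x ∈ B then 1 else 0)).sum = c * (l.countP (· ∈ B) : ℕ) := by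
  induction l with
  | nil => simp
  | cons x l ih =>
    rw [List.map_cons, List.sum_cons, ih, List.countP_cons]
    by_cases hx : x ∈ B
    · simp [hx]
      ring
    · simp [hx]

theorem stmt5 (A : Set (ℝ × ℝ)) (hA : A ⊆ K2)
    (m : SignedMeasure (ℝ × ℝ)) (hm : MemM0 (ind A) m) :
    ∃ (n : ℕ) (a : Fin n → ℝ) (x : Fin n → ℝ × ℝ),
      (∀ k, a k = 1 ∨ a k = -1) ∧ (∀ k, x k ∈ K2) ∧
      (∀ B : Set (ℝ × ℝ), MeasurableSet B →
        m B = ∑ k, a k * (if x k ∈ B then 1 else 0)) ∧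
      (∀ᵐ t : ℝ × ℝ,
        ind A t = ∑ k, a k * heav (t.1 - (x k).1) * heav (t.2 - (x k).2)) := by
  obtain ⟨p, q, hp, hq, hpq⟩ := exists_lists_signedMeasure_eq m
    (fun _ hB => mem_range_intCast_of_memM0_ind hm hB)
    (measurableSet_Icc.prod measurableSet_Icc) hm.2.1
  set L : List (ℝ × (ℝ × ℝ)) := p.map (fun x => (1, x)) ++ q.map (fun x => (-1, x)) with hL
  have hLmem : ∀ y ∈ L, (y.1 = 1 ∨ y.1 = -1) ∧ y.2 ∈ K2 := by
    intro y hy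
    simp only [hL, List.mem_append, List.mem_map] at hy
    rcases hy with ⟨x, hx, rfl⟩ | ⟨x, hx, rfl⟩
    · exact ⟨Or.inl rfl, hp x hx⟩
    · exact ⟨Or.inr rfl, hq x hx⟩
  have hsum : ∀ B : Set (ℝ × ℝ), MeasurableSet B →
      m B = ∑ k : Fin L.length, L[k].1 * (if L[k].2 ∈ B then 1 else 0) := by
    intro B hB
    refine Eq.trans ?_ (Fin.sum_univ_fun_getElem L fun y => y.1 * (if y.2 ∈ B then 1 else 0)).symm
    rw [hpq B hB, hL,
      List.map_append, List.sum_append, List.map_map, List.map_map]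
    have h₁ := List.sum_map_const_mul_ite_mem_eq_countP 1 p B
    have h₂ := List.sum_map_const_mul_ite_mem_eq_countP (-1) q B
    simp only [Function.comp_def]
    rw [h₁, h₂]
    ring
  refine ⟨L.length, fun k => L[k].1, fun k => L[k].2,
    fun k => (hLmem _ (List.getElem_mem k.2)).1, fun k => (hLmem _ (List.getElem_mem k.2)).2,
    hsum, ?_⟩
  filter_upwards [hm.2.2.2] with t ht
  rw [ht, hsum _ (measurableSet_Icc.prod measurableSet_Icc)]
  refine Finset.sum_congr rfl fun k _ => ?_
  obtain ⟨⟨h₁, -⟩, h₂, -⟩ := (hLmem _ (List.getElem_mem k.2)).2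
  simp only [Fin.getElem_fin, mem_prod, mem_Icc, h₁, h₂, true_and, heav, sub_nonneg,
    ← ite_and, mul_ite, mul_one, mul_zero]
  grind
end
end

section
/- Every ∇-decomposition of a set A ⊂ [0,1]^2 with 𝟙_A ∈ M_{D⊗D,0}(K) is also a (D⊗D)-decomposition; consequently, every (D⊗D)-indecomposable set is ∇-indecomposable, i.e., E_{D⊗D} ⊂ E_∇. Moreover the inclusion is strict: there exists a ∇-indecomposable set that is (D⊗D)-decomposable. -/
open MeasureTheory Set Filter

noncomputable section

def HasGradTV (f : ℝ × ℝ → ℝ) (r : ℝ) : Prop :=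
  ∃ ν₁ ν₂ : SignedMeasure (ℝ × ℝ), IsDeriv1 f ν₁ ∧ IsDeriv2 f ν₂ ∧ r = TV ν₁ + TV ν₂

def IsPartition (A A1 A2 : Set (ℝ × ℝ)) : Prop :=
  A1 ∪ A2 = A ∧ A1 ∩ A2 = ∅ ∧ 0 < volume A1 ∧ 0 < volume A2

def NablaDecomp (A A1 A2 : Set (ℝ × ℝ)) : Prop :=
  IsPartition A A1 A2 ∧ (∃ m1, MemM0 (ind A1) m1) ∧ (∃ m2, MemM0 (ind A2) m2) ∧
  ∃ r r1 r2 : ℝ, HasGradTV (ind A) r ∧ HasGradTV (ind A1) r1 ∧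
    HasGradTV (ind A2) r2 ∧ r1 + r2 = r

def DDDecomp (A A1 A2 : Set (ℝ × ℝ)) : Prop :=
  IsPartition A A1 A2 ∧ (∃ m1, MemM0 (ind A1) m1) ∧ (∃ m2, MemM0 (ind A2) m2) ∧
  ∃ m m1 m2 : SignedMeasure (ℝ × ℝ), IsMixedDeriv (ind A) m ∧
    IsMixedDeriv (ind A1) m1 ∧ IsMixedDeriv (ind A2) m2 ∧ TV m1 + TV m2 = TV m


section SignedMeasureBasics

variable {X : Type*} [MeasurableSpace X]

theorem totalVariation_add_le (μ ν : SignedMeasure X) :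
    (μ + ν).totalVariation ≤ μ.totalVariation + ν.totalVariation := by
  simp only [SignedMeasure.totalVariation_eq_variation]
  exact VectorMeasure.variation_add_le

theorem totalVariation_eq_zero_iff (μ : SignedMeasure X) {s : Set X} (hs : MeasurableSet s) :
    μ.totalVariation s = 0 ↔ ∀ t, t ⊆ s → MeasurableSet t → μ t = 0 := by
  rw [SignedMeasure.totalVariation_eq_variation]
  exact VectorMeasure.variation_apply_eq_zero hs

theorem apply_eq_zero_of_totalVariation (μ : SignedMeasure X) {s : Set X}
    (h : μ.totalVariation s = 0) : μ s = 0 := by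
  have := μ.enorm_le_totalVariation s
  rw [h] at this
  simpa using this

theorem apply_congr_of_totalVariation_sdiff (μ : SignedMeasure X) {s t : Set X}
    (hs : MeasurableSet s) (ht : MeasurableSet t) (hst : μ.totalVariation (s \ t) = 0)
    (hts : μ.totalVariation (t \ s) = 0) : μ s = μ t := by
  have h1 : μ s = μ (s \ t) + μ (s ∩ t) := by
    rw [← VectorMeasure.of_union (disjoint_sdiff_inter) (hs.diff ht) (hs.inter ht),
      Set.sdiff_union_inter]
  have h2 : μ t = μ (t \ s) + μ (s ∩ t) := by
    rw [inter_comm, ← VectorMeasure.of_union (disjoint_sdiff_inter) (ht.diff hs) (ht.inter hs),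
      Set.sdiff_union_inter]
  rw [h1, h2, apply_eq_zero_of_totalVariation μ hst, apply_eq_zero_of_totalVariation μ hts]

theorem totalVariation_singleton [MeasurableSingletonClass X] (μ : SignedMeasure X) (x : X) :
    μ.totalVariation {x} = ‖μ {x}‖ₑ := by
  refine le_antisymm ?_ (μ.enorm_le_totalVariation _)
  have hx : VectorMeasure.variation (μ.restrict {x}) {x} ≤
      (‖μ {x}‖ₑ • Measure.dirac x : Measure X) {x} := by
    refine VectorMeasure.variation_apply_le_of_forall_enorm_le (measurableSet_singleton x) ?_
    intro E hE hEx
    rcases Set.subset_singleton_iff_eq.1 hEx with rfl | rfl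
    · simp
    · rw [VectorMeasure.restrict_apply _ hE hE]
      simp
  rw [VectorMeasure.variation_restrict (measurableSet_singleton x),
    Measure.restrict_apply_self] at hx
  rw [SignedMeasure.totalVariation_eq_variation]
  simpa using hx

theorem totalVariation_eq_tsum_of_countable [MeasurableSingletonClass X] (μ : SignedMeasure X)
    {C : Set X} (hC : C.Countable) (h : μ.totalVariation Cᶜ = 0) :
    μ.totalVariation univ = ∑' p : C, ‖μ {(p : X)}‖ₑ := by
  have h1 : μ.totalVariation univ = μ.totalVariation C := by
    rw [← measure_add_measure_compl hC.measurableSet, h, add_zero]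
  have h2 := measure_biUnion (μ := μ.totalVariation) hC (f := fun x => {x})
    (fun x _ y _ hxy => by simpa using hxy) (fun x _ => measurableSet_singleton x)
  simpa only [totalVariation_singleton, biUnion_of_singleton, h1] using h2

theorem totalVariation_univ_add_of_atomic [MeasurableSingletonClass X] (μ ν : SignedMeasure X)
    {C : Set X} (hC : C.Countable) (hμ : μ.totalVariation Cᶜ = 0) (hν : ν.totalVariation Cᶜ = 0)
    (h : ∀ x, 0 ≤ μ {x} * ν {x}) :
    (μ + ν).totalVariation univ = μ.totalVariation univ + ν.totalVariation univ := by
  have h3 : (μ + ν).totalVariation Cᶜ = 0 := by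
    refine le_antisymm ((totalVariation_add_le μ ν _).trans ?_) (zero_le)
    simp [hμ, hν]
  rw [totalVariation_eq_tsum_of_countable μ hC hμ, totalVariation_eq_tsum_of_countable ν hC hν,
    totalVariation_eq_tsum_of_countable _ hC h3, ← ENNReal.tsum_add]
  refine tsum_congr fun p => ?_
  rw [_root_.add_apply, Real.enorm_eq_ofReal_abs, Real.enorm_eq_ofReal_abs,
    Real.enorm_eq_ofReal_abs, ← ENNReal.ofReal_add (abs_nonneg _) (abs_nonneg _),
    abs_add_eq_add_abs_iff _ _ |>.2]
  exact mul_nonneg_iff.1 (h p)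

theorem totalVariation_le_of_add (μ ν : SignedMeasure X)
    (h : (μ + ν).totalVariation univ = μ.totalVariation univ + ν.totalVariation univ)
    {s : Set X} (hs : MeasurableSet s) :
    μ.totalVariation s ≤ (μ + ν).totalVariation s := by
  have h1 := totalVariation_add_le μ ν sᶜ
  rw [← measure_add_measure_compl hs, ← measure_add_measure_compl (μ := μ.totalVariation) hs,
    ← measure_add_measure_compl (μ := ν.totalVariation) hs] at h
  have hf : ∀ (κ : SignedMeasure X) (t : Set X), κ.totalVariation t ≠ ⊤ :=
    fun κ t => measure_ne_top _ _
  have e1 := hf μ s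
  have e2 := hf μ sᶜ
  have e3 := hf ν s
  have e4 := hf ν sᶜ
  have e5 := hf (μ + ν) s
  have e6 := hf (μ + ν) sᶜ
  simp only [Measure.coe_add, Pi.add_apply] at h1
  lift μ.totalVariation s to NNReal using e1 with a1
  lift μ.totalVariation sᶜ to NNReal using e2 with a2
  lift ν.totalVariation s to NNReal using e3 with a3
  lift ν.totalVariation sᶜ to NNReal using e4 with a4
  lift (μ + ν).totalVariation s to NNReal using e5 with a5
  lift (μ + ν).totalVariation sᶜ to NNReal using e6 with a6
  norm_cast at *
  have := a3.2
  rw [← NNReal.coe_le_coe] at *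
  rw [← NNReal.coe_inj] at h
  push_cast at *
  linarith [a3.coe_nonneg]

/-- A signed measure whose values are integers has total variation without small values. -/
theorem totalVariation_eq_zero_of_lt_one (μ : SignedMeasure X)
    (hμ : ∀ s, MeasurableSet s → ∃ k : ℤ, μ s = k) {s : Set X} (hs : MeasurableSet s)
    (h : μ.totalVariation s < 1) : μ.totalVariation s = 0 := by
  rw [totalVariation_eq_zero_iff μ hs]
  intro t hts ht
  obtain ⟨k, hk⟩ := hμ t ht
  have h1 : ‖μ t‖ₑ < 1 :=
    (μ.enorm_le_totalVariation t).trans_lt ((measure_mono hts).trans_lt h)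
  rw [hk, Real.enorm_eq_ofReal_abs, ENNReal.ofReal_lt_one] at h1
  have h2 : |k| < 1 := by exact_mod_cast h1
  rw [hk, Int.abs_lt_one_iff.1 h2, Int.cast_zero]

theorem exists_int_of_isPiSystem (μ : SignedMeasure X) {C : Set (Set X)}
    (hgen : ‹MeasurableSpace X› = MeasurableSpace.generateFrom C) (hC : IsPiSystem C)
    (huniv : ∃ k : ℤ, μ univ = k) (h : ∀ s ∈ C, ∃ k : ℤ, μ s = k) :
    ∀ s, MeasurableSet s → ∃ k : ℤ, μ s = k := by
  intro s hs
  induction s, hs using MeasurableSpace.induction_on_inter hgen hC with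
  | empty => exact ⟨0, by simp⟩
  | basic t ht => exact h t ht
  | compl t ht ih =>
    obtain ⟨k, hk⟩ := ih
    obtain ⟨n, hn⟩ := huniv
    refine ⟨n - k, ?_⟩
    have := VectorMeasure.of_add_of_sdiff (v := μ) ht MeasurableSet.univ (subset_univ t)
    rw [compl_eq_univ_sdiff]
    push_cast
    linarith
  | iUnion f hd hf ih =>
    have hsum := VectorMeasure.hasSum_of_disjoint_iUnion (v := μ) hf hd
    have hcl : IsClosed (range ((↑) : ℤ → ℝ)) := Int.isClosedEmbedding_coe_real.isClosed_range
    have : μ (⋃ i, f i) ∈ range ((↑) : ℤ → ℝ) := by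
      refine hcl.mem_of_tendsto hsum (Eventually.of_forall fun t => ?_)
      choose k hk using ih
      exact ⟨∑ i ∈ t, k i, by push_cast; exact Finset.sum_congr rfl fun i _ => (hk i).symm⟩
    obtain ⟨k, hk⟩ := this
    exact ⟨k, hk.symm⟩

end SignedMeasureBasics

section Pairing

theorem sInt_eq_sub {μ : SignedMeasure (ℝ × ℝ)} {α β : Measure (ℝ × ℝ)} [IsFiniteMeasure α]
    [IsFiniteMeasure β] (h : μ = α.toSignedMeasure - β.toSignedMeasure) {φ : ℝ × ℝ → ℝ}
    (hφ : IsTest φ) : sInt μ φ = ∫ x, φ x ∂α - ∫ x, φ x ∂β := by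
  have hi : ∀ (κ : Measure (ℝ × ℝ)) [IsFiniteMeasure κ], Integrable φ κ := fun κ _ =>
    hφ.1.continuous.integrable_of_hasCompactSupport hφ.2
  have h1 : μ.toJordanDecomposition.posPart + β = α + μ.toJordanDecomposition.negPart := by
    rw [← Measure.toSignedMeasure_eq_toSignedMeasure_iff, Measure.toSignedMeasure_add,
      Measure.toSignedMeasure_add]
    exact sub_eq_sub_iff_add_eq_add.1 (μ.toSignedMeasure_toJordanDecomposition.trans h)
  have h2 : ∫ x, φ x ∂(μ.toJordanDecomposition.posPart + β) =
      ∫ x, φ x ∂(α + μ.toJordanDecomposition.negPart) := by rw [h1]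
  rw [integral_add_measure (hi _) (hi _), integral_add_measure (hi _) (hi _)] at h2
  unfold sInt
  linarith

theorem eq_posPart_sub_negPart (μ : SignedMeasure (ℝ × ℝ)) :
    μ = μ.toJordanDecomposition.posPart.toSignedMeasure -
      μ.toJordanDecomposition.negPart.toSignedMeasure :=
  μ.toSignedMeasure_toJordanDecomposition.symm

theorem sInt_add (μ ν : SignedMeasure (ℝ × ℝ)) {φ : ℝ × ℝ → ℝ} (hφ : IsTest φ) :
    sInt (μ + ν) φ = sInt μ φ + sInt ν φ := by
  have hi : ∀ (κ : Measure (ℝ × ℝ)) [IsFiniteMeasure κ], Integrable φ κ := fun κ _ =>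
    hφ.1.continuous.integrable_of_hasCompactSupport hφ.2
  have h : μ + ν = (μ.toJordanDecomposition.posPart +
      ν.toJordanDecomposition.posPart).toSignedMeasure -
      (μ.toJordanDecomposition.negPart + ν.toJordanDecomposition.negPart).toSignedMeasure := by
    rw [Measure.toSignedMeasure_add, Measure.toSignedMeasure_add]
    nth_rw 1 [eq_posPart_sub_negPart μ, eq_posPart_sub_negPart ν]
    abel
  rw [sInt_eq_sub h hφ, integral_add_measure (hi _) (hi _), integral_add_measure (hi _) (hi _)]
  unfold sInt
  ring

theorem sInt_neg (μ : SignedMeasure (ℝ × ℝ)) (φ : ℝ × ℝ → ℝ) :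
    sInt (-μ) φ = - sInt μ φ := by
  unfold sInt
  rw [SignedMeasure.toJordanDecomposition_neg]
  simp

theorem sInt_eq_zero_of_totalVariation {μ : SignedMeasure (ℝ × ℝ)} {U : Set (ℝ × ℝ)}
    (h : μ.totalVariation U = 0) {φ : ℝ × ℝ → ℝ} (hφ : tsupport φ ⊆ U) : sInt μ φ = 0 := by
  have h0 : ∀ x ∉ U, φ x = 0 := fun x hx => image_eq_zero_of_notMem_tsupport fun h => hx (hφ h)
  simp only [SignedMeasure.totalVariation, Measure.coe_add, Pi.add_apply, add_eq_zero] at h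
  have hz : ∀ κ : Measure (ℝ × ℝ), κ U = 0 → ∫ x, φ x ∂κ = 0 := by
    intro κ hκ
    refine integral_eq_zero_of_ae ?_
    filter_upwards [measure_eq_zero_iff_ae_notMem.1 hκ] with x hx using h0 x hx
  rw [sInt, hz _ h.1, hz _ h.2, sub_zero]

theorem exists_isTest_of_isCompact {C W : Set (ℝ × ℝ)} (hC : IsCompact C) (hW : IsOpen W)
    (h : C ⊆ W) : ∃ φ, IsTest φ ∧ tsupport φ ⊆ W ∧ (∀ x ∈ C, φ x = 1) ∧
      ∀ x, φ x ∈ Icc (0 : ℝ) 1 := by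
  obtain ⟨L, hL, hCL, hLW⟩ := exists_compact_between hC hW h
  obtain ⟨f, hf1, hf0, hf⟩ := exists_contMDiffMap_one_nhds_of_subset_interior
    (n := (⊤ : ℕ∞)) (modelWithCornersSelf ℝ (ℝ × ℝ)) hC.isClosed hCL
  have hs : tsupport f ⊆ L := closure_minimal (fun x hx => by
    by_contra h; exact hx (hf0 x h)) hL.isClosed
  refine ⟨f, ⟨f.contMDiff.contDiff, HasCompactSupport.of_support_subset_isCompact hL
    (subset_closure.trans hs)⟩, hs.trans hLW, fun x hx => ?_, hf⟩
  exact hf1.self_of_nhdsSet x hx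

theorem measure_le_of_integral_isTest_eq {α β : Measure (ℝ × ℝ)} [IsFiniteMeasure α]
    [IsFiniteMeasure β] {U : Set (ℝ × ℝ)}
    (h : ∀ φ, IsTest φ → tsupport φ ⊆ U → ∫ x, φ x ∂α = ∫ x, φ x ∂β) {W : Set (ℝ × ℝ)}
    (hW : IsOpen W) (hWU : W ⊆ U) : α W ≤ β W := by
  rw [hW.measure_eq_iSup_isCompact]
  refine iSup_le fun C => iSup_le fun hCW => iSup_le fun hC => ?_
  obtain ⟨φ, hφ, hsupp, h1, h01⟩ := exists_isTest_of_isCompact hC hW hCW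
  have hi : ∀ (κ : Measure (ℝ × ℝ)) [IsFiniteMeasure κ], Integrable φ κ := fun κ _ =>
    hφ.1.continuous.integrable_of_hasCompactSupport hφ.2
  have e1 : α.real C ≤ ∫ x, φ x ∂α := by
    rw [← integral_indicator_one hC.measurableSet]
    refine integral_mono ((integrable_const (1 : ℝ)).indicator hC.measurableSet) (hi _) fun x => ?_
    by_cases hx : x ∈ C
    · simp [hx, h1]
    · simpa [hx] using (h01 x).1
  have e2 : ∫ x, φ x ∂β ≤ β.real W := by
    rw [← integral_indicator_one hW.measurableSet]
    refine integral_mono (hi _) ((integrable_const (1 : ℝ)).indicator hW.measurableSet) fun x => ?_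
    by_cases hx : x ∈ W
    · simpa [hx] using (h01 x).2
    · simp [hx, image_eq_zero_of_notMem_tsupport fun h => hx (hsupp h)]
  rw [h φ hφ (hsupp.trans hWU)] at e1
  exact (ENNReal.toReal_le_toReal (measure_ne_top _ _) (measure_ne_top _ _)).1 (e1.trans e2)

theorem totalVariation_eq_zero_of_sInt_eq_zero {μ : SignedMeasure (ℝ × ℝ)} {U : Set (ℝ × ℝ)}
    (hU : IsOpen U) (h : ∀ φ, IsTest φ → tsupport φ ⊆ U → sInt μ φ = 0) :
    μ.totalVariation U = 0 := by
  set P := μ.toJordanDecomposition.posPart with hP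
  set N := μ.toJordanDecomposition.negPart with hN
  have hPN : ∀ W, IsOpen W → W ⊆ U → P W = N W := by
    intro W hW hWU
    refine le_antisymm (measure_le_of_integral_isTest_eq ?_ hW hWU)
      (measure_le_of_integral_isTest_eq ?_ hW hWU)
    · intro φ hφ hs
      exact sub_eq_zero.1 (h φ hφ hs)
    · intro φ hφ hs
      exact (sub_eq_zero.1 (h φ hφ hs)).symm
  have hr : P.restrict U = N.restrict U := by
    refine ext_of_generate_finite {s | IsOpen s} BorelSpace.measurable_eq isPiSystem_isOpen
      ?_ ?_
    · intro s (hs : IsOpen s)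
      rw [Measure.restrict_apply hs.measurableSet, Measure.restrict_apply hs.measurableSet]
      exact hPN _ (hs.inter hU) inter_subset_right
    · simpa using hPN U hU subset_rfl
  obtain ⟨S, hS, hPS, hNS⟩ := μ.toJordanDecomposition.mutuallySingular
  have hs : ∀ s, MeasurableSet s → P (s ∩ U) = N (s ∩ U) := fun s hs => by
    rw [← Measure.restrict_apply hs, hr, Measure.restrict_apply hs]
  have e1 : P (S ∩ U) = 0 := measure_mono_null inter_subset_left hPS
  have e2 : N (Sᶜ ∩ U) = 0 := measure_mono_null inter_subset_left hNS
  have hc : ∀ κ : Measure (ℝ × ℝ), κ (S ∩ U) = 0 → κ (Sᶜ ∩ U) = 0 → κ U = 0 := by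
    intro κ h1 h2
    rw [← measure_inter_add_sdiff U hS, inter_comm, h1, Set.sdiff_eq, inter_comm, h2, add_zero]
  rw [SignedMeasure.totalVariation, Measure.coe_add, Pi.add_apply,
    hc P e1 ((hs _ hS.compl).trans e2), hc N ((hs _ hS).symm.trans e1) e2, add_zero]

theorem eq_add_of_sInt_eq {μ ν κ : SignedMeasure (ℝ × ℝ)}
    (h : ∀ φ, IsTest φ → sInt μ φ = sInt ν φ + sInt κ φ) : μ = ν + κ := by
  have h0 : (μ + -(ν + κ)).totalVariation univ = 0 := by
    refine totalVariation_eq_zero_of_sInt_eq_zero isOpen_univ fun φ hφ _ => ?_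
    rw [sInt_add _ _ hφ, sInt_neg, sInt_add _ _ hφ, h φ hφ, add_neg_cancel]
  rw [totalVariation_eq_zero_iff _ MeasurableSet.univ] at h0
  rw [← sub_eq_zero, sub_eq_add_neg]
  ext s hs
  exact h0 s (subset_univ s) hs

end Pairing

section Atoms

/-- The points whose first or second coordinate is close to, but different from, that of `x`. -/
def puncturedCross (x : ℝ × ℝ) (r : ℝ) : Set (ℝ × ℝ) :=
  {y | (0 < |y.1 - x.1| ∧ |y.1 - x.1| < r) ∨ (0 < |y.2 - x.2| ∧ |y.2 - x.2| < r)}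

theorem measurableSet_puncturedCross (x : ℝ × ℝ) (r : ℝ) :
    MeasurableSet (puncturedCross x r) := by
  unfold puncturedCross
  measurability

theorem puncturedCross_mono (x : ℝ × ℝ) {r s : ℝ} (h : r ≤ s) :
    puncturedCross x r ⊆ puncturedCross x s := by
  rintro y (hy | hy)
  · exact Or.inl ⟨hy.1, hy.2.trans_le h⟩
  · exact Or.inr ⟨hy.1, hy.2.trans_le h⟩

theorem exists_measure_puncturedCross_lt (κ : Measure (ℝ × ℝ)) [IsFiniteMeasure κ] (x : ℝ × ℝ)
    {ε : ENNReal} (hε : 0 < ε) : ∃ r > 0, κ (puncturedCross x r) < ε := by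
  have h := tendsto_measure_biInter_gt (μ := κ) (s := puncturedCross x) (a := (0 : ℝ))
    (fun r _ => (measurableSet_puncturedCross x r).nullMeasurableSet)
    (fun i j _ hij => puncturedCross_mono x hij) ⟨1, one_pos, measure_ne_top _ _⟩
  have h0 : (⋂ r > (0 : ℝ), puncturedCross x r) = ∅ := by
    ext y
    simp only [mem_iInter, mem_empty_iff_false, iff_false, not_forall]
    have key : ∀ t : ℝ, ∃ r > 0, ∀ s, 0 < s → s ≤ r → ¬ (0 < |t| ∧ |t| < s) := by
      intro t
      by_cases ht : 0 < |t|
      · exact ⟨|t|, ht, fun s _ hs h => absurd h.2 (not_lt.2 hs)⟩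
      · exact ⟨1, one_pos, fun s _ _ h => ht h.1⟩
    obtain ⟨r1, hr1, h1⟩ := key (y.1 - x.1)
    obtain ⟨r2, hr2, h2⟩ := key (y.2 - x.2)
    refine ⟨min r1 r2, lt_min hr1 hr2, ?_⟩
    rintro (h | h)
    · exact h1 _ (lt_min hr1 hr2) (min_le_left _ _) h
    · exact h2 _ (lt_min hr1 hr2) (min_le_right _ _) h
  rw [h0, measure_empty] at h
  have h1 := (h.eventually (gt_mem_nhds hε)).and self_mem_nhdsWithin
  obtain ⟨r, hr, hr0⟩ := h1.exists
  exact ⟨r, hr0, hr⟩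

theorem apply_Icc_eq_apply_Iic {m : SignedMeasure (ℝ × ℝ)} (h : SuppIn m K2) (x : ℝ × ℝ) :
    m (Icc 0 x.1 ×ˢ Icc 0 x.2) = m (Iic x.1 ×ˢ Iic x.2) := by
  refine apply_congr_of_totalVariation_sdiff m (measurableSet_Icc.prod measurableSet_Icc)
    (measurableSet_Iic.prod measurableSet_Iic) ?_ ?_
  · rw [sdiff_eq_empty.2 (Set.prod_mono Icc_subset_Iic_self Icc_subset_Iic_self), measure_empty]
  · refine measure_mono_null ?_ h
    rintro y ⟨⟨h1, h2⟩, h3⟩ hy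
    exact h3 ⟨⟨hy.1.1, h1⟩, ⟨hy.2.1, h2⟩⟩

theorem ind_eq_zero_or_one (A : Set (ℝ × ℝ)) (x : ℝ × ℝ) : ind A x = 0 ∨ ind A x = 1 := by
  by_cases hx : x ∈ A <;> simp [ind, hx]

theorem ind_eq_one_iff {A : Set (ℝ × ℝ)} {x : ℝ × ℝ} : ind A x = 1 ↔ x ∈ A := by
  by_cases hx : x ∈ A <;> simp [ind, hx]

theorem side_upper {p y r : ℝ} (h1 : p < y) (h2 : y < p + r) (t : ℝ)
    (ht : ¬ (t ∈ Iic p ↔ t ≤ y)) : 0 < |t - p| ∧ |t - p| < r := by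
  simp only [mem_Iic] at ht
  have h3 : p < t := by
    by_contra! h
    exact ht ⟨fun _ => by linarith, fun _ => h⟩
  have h4 : t ≤ y := by
    by_contra! h
    exact ht ⟨fun _ => by linarith, fun _ => by linarith⟩
  rw [abs_of_pos (by linarith)]
  constructor <;> linarith

theorem side_lower {p y r : ℝ} (h1 : y < p) (h2 : p - r < y) (t : ℝ)
    (ht : ¬ (t ∈ Iio p ↔ t ≤ y)) : 0 < |t - p| ∧ |t - p| < r := by
  simp only [mem_Iio] at ht
  have h3 : t < p := by
    by_contra! h
    exact ht ⟨fun _ => by linarith, fun _ => by linarith⟩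
  have h4 : y < t := by
    by_contra! h
    exact ht ⟨fun _ => h, fun _ => h3⟩
  rw [abs_of_neg (by linarith)]
  constructor <;> linarith

theorem apply_Iic_of_sides (m : SignedMeasure (ℝ × ℝ)) {p y : ℝ × ℝ} {r : ℝ}
    {I J : Set ℝ} (hI : MeasurableSet I) (hJ : MeasurableSet J)
    (hIy : ∀ t, ¬ (t ∈ I ↔ t ≤ y.1) → 0 < |t - p.1| ∧ |t - p.1| < r)
    (hJy : ∀ t, ¬ (t ∈ J ↔ t ≤ y.2) → 0 < |t - p.2| ∧ |t - p.2| < r)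
    {ε : ENNReal} (hr : m.totalVariation (puncturedCross p r) < ε) :
    ‖m (Iic y.1 ×ˢ Iic y.2) - m (I ×ˢ J)‖ₑ < ε + ε := by
  have hB : MeasurableSet (Iic y.1 ×ˢ Iic y.2) := measurableSet_Iic.prod measurableSet_Iic
  have hIJ := hI.prod hJ
  have h1 : m (Iic y.1 ×ˢ Iic y.2) - m (I ×ˢ J) =
      m ((Iic y.1 ×ˢ Iic y.2) \ (I ×ˢ J)) - m ((I ×ˢ J) \ (Iic y.1 ×ˢ Iic y.2)) := by
    have e1 : m (Iic y.1 ×ˢ Iic y.2) = m ((Iic y.1 ×ˢ Iic y.2) \ (I ×ˢ J)) +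
        m ((Iic y.1 ×ˢ Iic y.2) ∩ (I ×ˢ J)) := by
      rw [← VectorMeasure.of_union disjoint_sdiff_inter (hB.diff hIJ) (hB.inter hIJ),
        Set.sdiff_union_inter]
    have e2 : m (I ×ˢ J) = m ((I ×ˢ J) \ (Iic y.1 ×ˢ Iic y.2)) +
        m ((Iic y.1 ×ˢ Iic y.2) ∩ (I ×ˢ J)) := by
      rw [inter_comm, ← VectorMeasure.of_union disjoint_sdiff_inter (hIJ.diff hB) (hIJ.inter hB),
        Set.sdiff_union_inter]
    rw [e1, e2]
    ring
  rw [h1]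
  refine (enorm_sub_le).trans_lt (ENNReal.add_lt_add ?_ ?_)
  all_goals
    refine (m.enorm_le_totalVariation _).trans_lt ((measure_mono ?_).trans_lt hr)
    rintro t ⟨⟨h2, h3⟩, h4⟩
    by_cases h5 : t.1 ∈ I ↔ t.1 ≤ y.1
    · refine Or.inr (hJy t.2 fun h6 => h4 ?_)
      simp only [mem_prod, mem_Iic] at h2 h3 ⊢
      tauto
    · exact Or.inl (hIy t.1 h5)

theorem apply_Iic_mem_of_memM0 {A : Set (ℝ × ℝ)} {m : SignedMeasure (ℝ × ℝ)}
    (h : MemM0 (ind A) m) (x : ℝ × ℝ) :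
    m (Iic x.1 ×ˢ Iic x.2) ∈ ({0, 1} : Set ℝ) := by
  have hcl : IsClosed ({0, 1} : Set ℝ) := (Set.toFinite _).isClosed
  rw [← hcl.closure_eq, EMetric.mem_closure_iff]
  intro ε hε
  obtain ⟨r, hr, hlt⟩ := exists_measure_puncturedCross_lt m.totalVariation x
    (ENNReal.half_pos hε.ne')
  have hd := Measure.dense_of_ae h.2.2.2
  obtain ⟨y, hy, hyU⟩ := hd.exists_mem_open
    (isOpen_Ioo.prod isOpen_Ioo : IsOpen (Ioo x.1 (x.1 + r) ×ˢ Ioo x.2 (x.2 + r)))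
    ⟨(x.1 + r / 2, x.2 + r / 2), by constructor <;> constructor <;> simp <;> linarith⟩
  have hy' : ind A y = m (Iic y.1 ×ˢ Iic y.2) := by
    rw [← apply_Icc_eq_apply_Iic h.2.1]; exact hy
  refine ⟨ind A y, by simpa using ind_eq_zero_or_one A y, ?_⟩
  rw [hy', edist_comm, edist_eq_enorm_sub, ← ENNReal.add_halves ε]
  obtain ⟨⟨h1, h2⟩, ⟨h3, h4⟩⟩ := hyU
  exact apply_Iic_of_sides m measurableSet_Iic measurableSet_Iic (side_upper h1 h2)
    (side_upper h3 h4) hlt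

theorem exists_int_of_memM0 {A : Set (ℝ × ℝ)} {m : SignedMeasure (ℝ × ℝ)}
    (h : MemM0 (ind A) m) : ∀ s, MeasurableSet s → ∃ k : ℤ, m s = k := by
  have hval : ∀ x : ℝ × ℝ, ∃ k : ℤ, m (Iic x.1 ×ˢ Iic x.2) = k := by
    intro x
    rcases apply_Iic_mem_of_memM0 h x with h | h
    · exact ⟨0, by simpa using h⟩
    · exact ⟨1, by simpa using h⟩
  have hspan : IsCountablySpanning (range (Iic : ℝ → Set ℝ)) :=
    ⟨fun n => Iic (n : ℝ), fun n => ⟨_, rfl⟩, by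
      ext x
      simpa using exists_nat_ge x⟩
  have hb : (inferInstance : MeasurableSpace ℝ) = MeasurableSpace.generateFrom (range Iic) :=
    (BorelSpace.measurable_eq (α := ℝ)).trans (borel_eq_generateFrom_Iic ℝ)
  refine exists_int_of_isPiSystem m (C := image2 (· ×ˢ ·) (range Iic) (range Iic))
    (generateFrom_eq_prod hb.symm hb.symm hspan hspan).symm
    (isPiSystem_Iic.prod isPiSystem_Iic) ?_ ?_
  · obtain ⟨k, hk⟩ := hval (1, 1)
    refine ⟨k, hk ▸ ?_⟩
    refine apply_congr_of_totalVariation_sdiff m MeasurableSet.univ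
      (measurableSet_Iic.prod measurableSet_Iic) ?_ (by simp)
    refine measure_mono_null ?_ h.2.1
    rintro y ⟨_, h3⟩ hy
    exact h3 ⟨hy.1.2, hy.2.2⟩
  · rintro _ ⟨_, ⟨a, rfl⟩, _, ⟨b, rfl⟩, rfl⟩
    exact hval (a, b)

theorem exists_totalVariation_puncturedCross_eq_zero {A : Set (ℝ × ℝ)}
    {m : SignedMeasure (ℝ × ℝ)} (h : MemM0 (ind A) m) (x : ℝ × ℝ) :
    ∃ r > 0, m.totalVariation (puncturedCross x r) = 0 := by
  obtain ⟨r, hr, hlt⟩ := exists_measure_puncturedCross_lt m.totalVariation x one_pos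
  exact ⟨r, hr, totalVariation_eq_zero_of_lt_one m (exists_int_of_memM0 h)
    (measurableSet_puncturedCross x r) hlt⟩

theorem exists_countable_totalVariation_compl_eq_zero {A : Set (ℝ × ℝ)}
    {m : SignedMeasure (ℝ × ℝ)} (h : MemM0 (ind A) m) :
    ∃ C : Set (ℝ × ℝ), C.Countable ∧ m.totalVariation Cᶜ = 0 := by
  refine ⟨{x | 0 < m.totalVariation {x}}, Measure.countable_meas_pos_of_disjoint_iUnion
    (fun x => measurableSet_singleton x) fun x y hxy => by simpa using hxy, ?_⟩
  refine measure_null_of_locally_null _ fun x hx => ?_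
  obtain ⟨r, hr, h0⟩ := exists_totalVariation_puncturedCross_eq_zero h x
  refine ⟨Metric.ball x r, mem_nhdsWithin_of_mem_nhds (Metric.ball_mem_nhds x hr), ?_⟩
  refine measure_mono_null (t := {x} ∪ puncturedCross x r) ?_
    (measure_union_null (by simpa using hx) h0)
  intro y hy
  rw [Metric.mem_ball, Prod.dist_eq, max_lt_iff, Real.dist_eq, Real.dist_eq] at hy
  by_cases h1 : y.1 = x.1
  · by_cases h2 : y.2 = x.2
    · exact Or.inl (Prod.ext h1 h2)
    · exact Or.inr (Or.inr ⟨abs_pos.2 (sub_ne_zero.2 h2), hy.2⟩)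
  · exact Or.inr (Or.inl ⟨abs_pos.2 (sub_ne_zero.2 h1), hy.1⟩)

theorem apply_singleton_eq (m : SignedMeasure (ℝ × ℝ)) (p : ℝ × ℝ) :
    m {p} = m (Iic p.1 ×ˢ Iic p.2) - m (Iio p.1 ×ˢ Iic p.2) - m (Iic p.1 ×ˢ Iio p.2) +
      m (Iio p.1 ×ˢ Iio p.2) := by
  have h1 : m (Iic p.1 ×ˢ Iic p.2) = m (Iio p.1 ×ˢ Iic p.2) + m ({p.1} ×ˢ Iic p.2) := by
    rw [← VectorMeasure.of_union _ (measurableSet_Iio.prod measurableSet_Iic)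
      ((measurableSet_singleton _).prod measurableSet_Iic), ← union_prod, Iio_union_right]
    exact Disjoint.set_prod_left (by simp) _ _
  have h2 : m (Iic p.1 ×ˢ Iio p.2) = m (Iio p.1 ×ˢ Iio p.2) + m ({p.1} ×ˢ Iio p.2) := by
    rw [← VectorMeasure.of_union _ (measurableSet_Iio.prod measurableSet_Iio)
      ((measurableSet_singleton _).prod measurableSet_Iio), ← union_prod, Iio_union_right]
    exact Disjoint.set_prod_left (by simp) _ _
  have h3 : m ({p.1} ×ˢ Iic p.2) = m ({p.1} ×ˢ Iio p.2) + m {p} := by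
    have : ({p} : Set (ℝ × ℝ)) = {p.1} ×ˢ {p.2} := by simp
    rw [this, ← VectorMeasure.of_union _ ((measurableSet_singleton _).prod measurableSet_Iio)
      ((measurableSet_singleton _).prod (measurableSet_singleton _)), ← prod_union,
      Iio_union_right]
    exact Disjoint.set_prod_right (by simp) _ _
  linarith

theorem ind_ae_eq_of_sides {A : Set (ℝ × ℝ)} {m : SignedMeasure (ℝ × ℝ)} (h : MemM0 (ind A) m)
    {p : ℝ × ℝ} {r : ℝ} (hr : m.totalVariation (puncturedCross p r) = 0) {I J S T : Set ℝ}
    (hI : MeasurableSet I) (hJ : MeasurableSet J)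
    (hS : ∀ y ∈ S, ∀ t, ¬ (t ∈ I ↔ t ≤ y) → 0 < |t - p.1| ∧ |t - p.1| < r)
    (hT : ∀ y ∈ T, ∀ t, ¬ (t ∈ J ↔ t ≤ y) → 0 < |t - p.2| ∧ |t - p.2| < r) :
    ∀ᵐ y : ℝ × ℝ, y ∈ S ×ˢ T → ind A y = m (I ×ˢ J) := by
  filter_upwards [h.2.2.2] with y hy hyST
  rw [hy, apply_Icc_eq_apply_Iic h.2.1, ← sub_eq_zero, ← enorm_eq_zero]
  refine le_antisymm (le_of_forall_gt fun ε hε => ?_) (zero_le)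
  rw [← ENNReal.add_halves ε]
  exact apply_Iic_of_sides m hI hJ (hS _ hyST.1) (hT _ hyST.2)
    (hr ▸ ENNReal.half_pos hε.ne')

/-- In a convex open set that is almost covered by `A₁ ∪ A₂`, one of the two sets is null. -/
def Separated (A₁ A₂ : Set (ℝ × ℝ)) : Prop :=
  ∀ U : Set (ℝ × ℝ), IsOpen U → Convex ℝ U → (∀ᵐ y : ℝ × ℝ, y ∈ U → y ∈ A₁ ∪ A₂) →
    (∀ᵐ y : ℝ × ℝ, y ∈ U → y ∉ A₁) ∨ (∀ᵐ y : ℝ × ℝ, y ∈ U → y ∉ A₂)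

theorem exists_mem_of_ae {Q : Set (ℝ × ℝ)} (hQ : IsOpen Q) (hne : Q.Nonempty)
    {P : ℝ × ℝ → Prop} (h : ∀ᵐ y : ℝ × ℝ, y ∈ Q → P y) : ∃ y ∈ Q, P y := by
  obtain ⟨y, hy, hyQ⟩ := (Measure.dense_of_ae h).exists_mem_open hQ hne
  exact ⟨y, hyQ, hy hyQ⟩

theorem ind_values {A₁ A₂ : Set (ℝ × ℝ)} (hd : A₁ ∩ A₂ = ∅) {Q : Set (ℝ × ℝ)} (hQ : IsOpen Q)
    (hne : Q.Nonempty) {a₁ a₂ : ℝ} (h₁ : ∀ᵐ y : ℝ × ℝ, y ∈ Q → ind A₁ y = a₁)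
    (h₂ : ∀ᵐ y : ℝ × ℝ, y ∈ Q → ind A₂ y = a₂) :
    (a₁ = 0 ∧ a₂ = 0) ∨ (a₁ = 1 ∧ a₂ = 0) ∨ (a₁ = 0 ∧ a₂ = 1) := by
  obtain ⟨y, -, rfl, rfl⟩ := exists_mem_of_ae hQ hne
    (P := fun y => ind A₁ y = a₁ ∧ ind A₂ y = a₂) (by
      filter_upwards [h₁, h₂] with y h1 h2 hy using ⟨h1 hy, h2 hy⟩)
  have hn : ¬ (y ∈ A₁ ∧ y ∈ A₂) := fun h => by
    have : y ∈ A₁ ∩ A₂ := h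
    simp [hd] at this
  by_cases h1 : y ∈ A₁ <;> by_cases h2 : y ∈ A₂ <;> simp_all [ind]

theorem Separated.not_adjacent {A₁ A₂ : Set (ℝ × ℝ)} (h : Separated A₁ A₂)
    {U Q Q' : Set (ℝ × ℝ)} (hU : IsOpen U) (hUc : Convex ℝ U) (hQ : IsOpen Q) (hQ' : IsOpen Q')
    (hne : Q.Nonempty) (hne' : Q'.Nonempty) (hQU : Q ⊆ U) (hQU' : Q' ⊆ U)
    (hcov : ∀ᵐ y : ℝ × ℝ, y ∈ U → y ∈ Q ∪ Q') {a c : ℝ}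
    (ha : ∀ᵐ y : ℝ × ℝ, y ∈ Q → ind A₁ y = a) (hc : ∀ᵐ y : ℝ × ℝ, y ∈ Q' → ind A₂ y = c) :
    ¬ (a = 1 ∧ c = 1) := by
  rintro ⟨rfl, rfl⟩
  simp only [ind_eq_one_iff] at ha hc
  rcases h U hU hUc (by
    filter_upwards [hcov, ha, hc] with y h1 h2 h3 hy
    exact (h1 hy).imp h2 h3) with h | h
  · obtain ⟨y, hy, h1, h2⟩ := exists_mem_of_ae hQ hne (P := fun y => y ∈ A₁ ∧ y ∉ A₁) (by
      filter_upwards [ha, h] with y h1 h2 hy using ⟨h1 hy, h2 (hQU hy)⟩)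
    exact h2 h1
  · obtain ⟨y, hy, h1, h2⟩ := exists_mem_of_ae hQ' hne' (P := fun y => y ∈ A₂ ∧ y ∉ A₂) (by
      filter_upwards [hc, h] with y h1 h2 hy using ⟨h1 hy, h2 (hQU' hy)⟩)
    exact h2 h1

theorem ae_fst_ne (c : ℝ) : ∀ᵐ y : ℝ × ℝ, y.1 ≠ c := by
  have : volume (({c} : Set ℝ) ×ˢ (univ : Set ℝ)) = 0 := by
    rw [Measure.volume_eq_prod, Measure.prod_prod]
    simp
  filter_upwards [measure_eq_zero_iff_ae_notMem.1 this] with y hy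
  simpa using hy

theorem ae_snd_ne (c : ℝ) : ∀ᵐ y : ℝ × ℝ, y.2 ≠ c := by
  have : volume ((univ : Set ℝ) ×ˢ ({c} : Set ℝ)) = 0 := by
    rw [Measure.volume_eq_prod, Measure.prod_prod]
    simp
  filter_upwards [measure_eq_zero_iff_ae_notMem.1 this] with y hy
  simpa using hy

theorem Separated.symm {A₁ A₂ : Set (ℝ × ℝ)} (h : Separated A₁ A₂) : Separated A₂ A₁ :=
  fun U hU hUc hcov => (h U hU hUc (by rwa [union_comm])).symm

theorem mul_apply_singleton_nonneg {A₁ A₂ : Set (ℝ × ℝ)} {m₁ m₂ : SignedMeasure (ℝ × ℝ)}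
    (h₁ : MemM0 (ind A₁) m₁) (h₂ : MemM0 (ind A₂) m₂) (hd : A₁ ∩ A₂ = ∅)
    (hs : Separated A₁ A₂) (p : ℝ × ℝ) : 0 ≤ m₁ {p} * m₂ {p} := by
  obtain ⟨r₁, hr₁, hz₁⟩ := exists_totalVariation_puncturedCross_eq_zero h₁ p
  obtain ⟨r₂, hr₂, hz₂⟩ := exists_totalVariation_puncturedCross_eq_zero h₂ p
  obtain ⟨r, hr, hz₁, hz₂⟩ : ∃ r > 0, m₁.totalVariation (puncturedCross p r) = 0 ∧
      m₂.totalVariation (puncturedCross p r) = 0 :=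
    ⟨min r₁ r₂, lt_min hr₁ hr₂,
      measure_mono_null (puncturedCross_mono p (min_le_left _ _)) hz₁,
      measure_mono_null (puncturedCross_mono p (min_le_right _ _)) hz₂⟩
  have up : ∀ c : ℝ, ∀ y ∈ Ioo c (c + r), ∀ t, ¬ (t ∈ Iic c ↔ t ≤ y) →
      0 < |t - c| ∧ |t - c| < r := fun c y hy => side_upper hy.1 hy.2
  have lo : ∀ c : ℝ, ∀ y ∈ Ioo (c - r) c, ∀ t, ¬ (t ∈ Iio c ↔ t ≤ y) →
      0 < |t - c| ∧ |t - c| < r := fun c y hy => side_lower hy.2 hy.1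
  have mc := fun c : ℝ => (measurableSet_Iic : MeasurableSet (Iic c))
  have mo := fun c : ℝ => (measurableSet_Iio : MeasurableSet (Iio c))
  have a₁ := ind_ae_eq_of_sides h₁ hz₁ (mc _) (mc _) (up _) (up _)
  have b₁ := ind_ae_eq_of_sides h₁ hz₁ (mo _) (mc _) (lo _) (up _)
  have c₁ := ind_ae_eq_of_sides h₁ hz₁ (mc _) (mo _) (up _) (lo _)
  have d₁ := ind_ae_eq_of_sides h₁ hz₁ (mo _) (mo _) (lo _) (lo _)
  have a₂ := ind_ae_eq_of_sides h₂ hz₂ (mc _) (mc _) (up _) (up _)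
  have b₂ := ind_ae_eq_of_sides h₂ hz₂ (mo _) (mc _) (lo _) (up _)
  have c₂ := ind_ae_eq_of_sides h₂ hz₂ (mc _) (mo _) (up _) (lo _)
  have d₂ := ind_ae_eq_of_sides h₂ hz₂ (mo _) (mo _) (lo _) (lo _)
  have neu : ∀ c : ℝ, (Ioo c (c + r)).Nonempty := fun c => nonempty_Ioo.2 (by linarith)
  have nel : ∀ c : ℝ, (Ioo (c - r) c).Nonempty := fun c => nonempty_Ioo.2 (by linarith)
  have op : ∀ u v s t : ℝ, IsOpen (Ioo u v ×ˢ Ioo s t) := fun _ _ _ _ => isOpen_Ioo.prod isOpen_Ioo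
  have cv : ∀ u v s t : ℝ, Convex ℝ (Ioo u v ×ˢ Ioo s t) :=
    fun u v s t => (convex_Ioo u v).prod (convex_Ioo s t)
  have va := ind_values hd (op _ _ _ _) ((neu _).prod (neu _)) a₁ a₂
  have vb := ind_values hd (op _ _ _ _) ((nel _).prod (neu _)) b₁ b₂
  have vc := ind_values hd (op _ _ _ _) ((neu _).prod (nel _)) c₁ c₂
  have vd := ind_values hd (op _ _ _ _) ((nel _).prod (nel _)) d₁ d₂
  have su : ∀ c : ℝ, Ioo c (c + r) ⊆ Ioo (c - r) (c + r) :=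
    fun c => Ioo_subset_Ioo_left (by linarith)
  have sl : ∀ c : ℝ, Ioo (c - r) c ⊆ Ioo (c - r) (c + r) :=
    fun c => Ioo_subset_Ioo_right (by linarith)
  have split : ∀ {c t : ℝ}, t ≠ c → t ∈ Ioo (c - r) (c + r) →
      t ∈ Ioo (c - r) c ∨ t ∈ Ioo c (c + r) :=
    fun hne ht => (lt_or_gt_of_ne hne).imp (fun h => ⟨ht.1, h⟩) (fun h => ⟨h, ht.2⟩)
  have cov1 : ∀ T : Set ℝ, ∀ᵐ y : ℝ × ℝ, y ∈ Ioo (p.1 - r) (p.1 + r) ×ˢ T →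
      y ∈ Ioo p.1 (p.1 + r) ×ˢ T ∪ Ioo (p.1 - r) p.1 ×ˢ T := by
    intro T
    filter_upwards [ae_fst_ne p.1] with y hy hyU
    exact ((split hy hyU.1).imp (fun h => ⟨h, hyU.2⟩) (fun h => ⟨h, hyU.2⟩)).symm
  have cov2 : ∀ T : Set ℝ, ∀ᵐ y : ℝ × ℝ, y ∈ T ×ˢ Ioo (p.2 - r) (p.2 + r) →
      y ∈ T ×ˢ Ioo p.2 (p.2 + r) ∪ T ×ˢ Ioo (p.2 - r) p.2 := by
    intro T
    filter_upwards [ae_snd_ne p.2] with y hy hyU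
    exact ((split hy hyU.2).imp (fun h => ⟨hyU.1, h⟩) (fun h => ⟨hyU.1, h⟩)).symm
  have adj1 : ∀ {B₁ B₂ : Set (ℝ × ℝ)} {u v : ℝ} {T : Set ℝ}, Separated B₁ B₂ → IsOpen T →
      Convex ℝ T → T.Nonempty →
      (∀ᵐ y : ℝ × ℝ, y ∈ Ioo p.1 (p.1 + r) ×ˢ T → ind B₁ y = u) →
      (∀ᵐ y : ℝ × ℝ, y ∈ Ioo (p.1 - r) p.1 ×ˢ T → ind B₂ y = v) → ¬ (u = 1 ∧ v = 1) :=
    fun hs hT hTc hTn hu hv => hs.not_adjacent (isOpen_Ioo.prod hT) ((convex_Ioo _ _).prod hTc)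
      (isOpen_Ioo.prod hT) (isOpen_Ioo.prod hT) ((neu _).prod hTn) ((nel _).prod hTn)
      (Set.prod_mono (su _) subset_rfl) (Set.prod_mono (sl _) subset_rfl) (cov1 _) hu hv
  have adj2 : ∀ {B₁ B₂ : Set (ℝ × ℝ)} {u v : ℝ} {T : Set ℝ}, Separated B₁ B₂ → IsOpen T →
      Convex ℝ T → T.Nonempty →
      (∀ᵐ y : ℝ × ℝ, y ∈ T ×ˢ Ioo p.2 (p.2 + r) → ind B₁ y = u) →
      (∀ᵐ y : ℝ × ℝ, y ∈ T ×ˢ Ioo (p.2 - r) p.2 → ind B₂ y = v) → ¬ (u = 1 ∧ v = 1) :=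
    fun hs hT hTc hTn hu hv => hs.not_adjacent (hT.prod isOpen_Ioo) (hTc.prod (convex_Ioo _ _))
      (hT.prod isOpen_Ioo) (hT.prod isOpen_Ioo) (hTn.prod (neu _)) (hTn.prod (nel _))
      (Set.prod_mono subset_rfl (su _)) (Set.prod_mono subset_rfl (sl _)) (cov2 _) hu hv
  have n1 := adj1 hs isOpen_Ioo (convex_Ioo _ _) (neu _) a₁ b₂
  have n2 := adj1 hs.symm isOpen_Ioo (convex_Ioo _ _) (neu _) a₂ b₁
  have n3 := adj1 hs isOpen_Ioo (convex_Ioo _ _) (nel _) c₁ d₂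
  have n4 := adj1 hs.symm isOpen_Ioo (convex_Ioo _ _) (nel _) c₂ d₁
  have n5 := adj2 hs isOpen_Ioo (convex_Ioo _ _) (neu _) a₁ c₂
  have n6 := adj2 hs.symm isOpen_Ioo (convex_Ioo _ _) (neu _) a₂ c₁
  have n7 := adj2 hs isOpen_Ioo (convex_Ioo _ _) (nel _) b₁ d₂
  have n8 := adj2 hs.symm isOpen_Ioo (convex_Ioo _ _) (nel _) b₂ d₁
  rw [apply_singleton_eq m₁, apply_singleton_eq m₂]
  clear * - va vb vc vd n1 n2 n3 n4 n5 n6 n7 n8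
  generalize m₁ (Iic p.1 ×ˢ Iic p.2) = x1 at *
  generalize m₁ (Iio p.1 ×ˢ Iic p.2) = x2 at *
  generalize m₁ (Iic p.1 ×ˢ Iio p.2) = x3 at *
  generalize m₁ (Iio p.1 ×ˢ Iio p.2) = x4 at *
  generalize m₂ (Iic p.1 ×ˢ Iic p.2) = y1 at *
  generalize m₂ (Iio p.1 ×ˢ Iic p.2) = y2 at *
  generalize m₂ (Iic p.1 ×ˢ Iio p.2) = y3 at *
  generalize m₂ (Iio p.1 ×ˢ Iio p.2) = y4 at *
  rcases va with ⟨rfl, rfl⟩ | ⟨rfl, rfl⟩ | ⟨rfl, rfl⟩ <;>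
  rcases vb with ⟨rfl, rfl⟩ | ⟨rfl, rfl⟩ | ⟨rfl, rfl⟩ <;>
  first
  | exact absurd ⟨rfl, rfl⟩ n1
  | exact absurd ⟨rfl, rfl⟩ n2
  | (rcases vc with ⟨rfl, rfl⟩ | ⟨rfl, rfl⟩ | ⟨rfl, rfl⟩ <;>
      rcases vd with ⟨rfl, rfl⟩ | ⟨rfl, rfl⟩ | ⟨rfl, rfl⟩ <;>
      first
      | exact absurd ⟨rfl, rfl⟩ n3
      | exact absurd ⟨rfl, rfl⟩ n4
      | exact absurd ⟨rfl, rfl⟩ n5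
      | exact absurd ⟨rfl, rfl⟩ n6
      | exact absurd ⟨rfl, rfl⟩ n7
      | exact absurd ⟨rfl, rfl⟩ n8
      | norm_num)

end Atoms

section LocallyConstant

theorem IsTest.differentiable {φ : ℝ × ℝ → ℝ} (hφ : IsTest φ) : Differentiable ℝ φ :=
  hφ.1.differentiable (by simp)

theorem IsTest.fderiv_apply {φ : ℝ × ℝ → ℝ} (hφ : IsTest φ) (v : ℝ × ℝ) :
    IsTest (fun x => fderiv ℝ φ x v) := by
  refine ⟨(hφ.1.fderiv_right (m := (⊤ : ℕ∞)) (by exact_mod_cast le_rfl)).clm_apply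
    contDiff_const, ?_⟩
  exact hφ.2.fderiv_apply (𝕜 := ℝ) v

theorem IsTest.integrable {φ : ℝ × ℝ → ℝ} (hφ : IsTest φ) {μ : Measure (ℝ × ℝ)}
    [IsFiniteMeasureOnCompacts μ] : Integrable φ μ :=
  hφ.1.continuous.integrable_of_hasCompactSupport hφ.2

theorem IsTest.integrable_mul {φ f : ℝ × ℝ → ℝ} (hφ : IsTest φ) (hf : Integrable f) :
    Integrable (fun x => f x * φ x) := by
  obtain ⟨C, hC⟩ := hφ.2.exists_bound_of_continuous hφ.1.continuous
  exact hf.mul_bdd (c := C) hφ.1.continuous.aestronglyMeasurable (ae_of_all _ hC)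

theorem IsTest.integral_fderiv {φ : ℝ × ℝ → ℝ} (hφ : IsTest φ) (v : ℝ × ℝ) :
    ∫ x, fderiv ℝ φ x v = 0 := by
  have := integral_mul_fderiv_eq_neg_fderiv_mul_of_integrable (μ := (volume : Measure (ℝ × ℝ)))
    (𝕜 := ℝ) (f := fun _ => 1) (g := φ) (v := v) (by simp)
    (by simpa using (hφ.fderiv_apply v).integrable) (by simpa using hφ.integrable)
    (fun x _ => by fun_prop) (fun x _ => hφ.differentiable x)
  simpa using this

theorem IsTest.comp_sub {φ : ℝ × ℝ → ℝ} (hφ : IsTest φ) (h : ℝ × ℝ) :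
    IsTest (fun x => φ (x - h)) :=
  ⟨hφ.1.comp (contDiff_id.sub contDiff_const),
    hφ.2.comp_homeomorph (Homeomorph.subRight h)⟩

theorem tsupport_comp_sub (φ : ℝ × ℝ → ℝ) (h : ℝ × ℝ) :
    tsupport (fun x => φ (x - h)) = {x | x - h ∈ tsupport φ} :=
  tsupport_comp_eq_preimage φ (Homeomorph.subRight h)

theorem integral_mul_comp_sub_const {f ψ : ℝ × ℝ → ℝ} {U : Set (ℝ × ℝ)}
    (hf : Integrable f) (hU : Convex ℝ U)
    (h0 : ∀ v : ℝ × ℝ, ∀ φ, IsTest φ → tsupport φ ⊆ U → ∫ x, f x * fderiv ℝ φ x v = 0)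
    (h : ℝ × ℝ) (hψ : IsTest ψ) (hψU : ∀ x ∈ tsupport ψ, x ∈ U ∧ x + h ∈ U) :
    ∫ x, f x * ψ (x - h) = ∫ x, f x * ψ x := by
  obtain ⟨C, hC⟩ := (hψ.fderiv_apply h).2.exists_bound_of_continuous
    (hψ.fderiv_apply h).1.continuous
  have hder : ∀ (t : ℝ) (x : ℝ × ℝ), HasDerivAt (fun s : ℝ => ψ (x - s • h))
      (-fderiv ℝ ψ (x - t • h) h) t := by
    intro t x
    have h1 : HasDerivAt (fun s : ℝ => x - s • h) (-h) t := by
      simpa using ((hasDerivAt_id t).smul_const h).const_sub x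
    have h2 := (hψ.differentiable (x - t • h)).hasFDerivAt.comp_hasDerivAt t h1
    rwa [map_neg] at h2
  have key : ∀ t : ℝ, HasDerivAt (fun s : ℝ => ∫ x, f x * ψ (x - s • h))
      (∫ x, f x * (-fderiv ℝ ψ (x - t • h) h)) t := by
    intro t
    refine (hasDerivAt_integral_of_dominated_loc_of_deriv_le (s := univ)
      (bound := fun x => |f x| * C) univ_mem
      (Eventually.of_forall fun s => ((hψ.comp_sub (s • h)).integrable_mul hf).1)
      ((hψ.comp_sub (t • h)).integrable_mul hf)
      ((((hψ.fderiv_apply h).comp_sub (t • h)).integrable_mul hf).neg.1.congr ?_)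
      (ae_of_all _ fun x s _ => ?_) (hf.abs.mul_const C)
      (ae_of_all _ fun x s _ => (hder s x).const_mul (f x))).2
    · exact ae_of_all _ fun x => by simp
    · rw [norm_mul, norm_neg, Real.norm_eq_abs (f x)]
      exact mul_le_mul_of_nonneg_left (hC _) (abs_nonneg _)
  have hzero : ∀ t ∈ Icc (0 : ℝ) 1, ∫ x, f x * (-fderiv ℝ ψ (x - t • h) h) = 0 := by
    intro t ht
    have := h0 h _ (hψ.comp_sub (t • h)) (by
      rw [tsupport_comp_sub]
      intro x hx
      obtain ⟨hx1, hx2⟩ := hψU _ hx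
      have := hU hx1 hx2 (sub_nonneg.2 ht.2) ht.1 (by ring)
      convert this using 1
      module)
    have e : ∀ x, fderiv ℝ (fun y => ψ (y - t • h)) x = fderiv ℝ ψ (x - t • h) := fun x => by
      exact fderiv_comp_sub _
    simp only [e] at this
    simp only [mul_neg, integral_neg, this, neg_zero]
  have := constant_of_has_deriv_right_zero (f := fun s : ℝ => ∫ x, f x * ψ (x - s • h))
    (a := 0) (b := 1) (fun t _ => (key t).continuousAt.continuousWithinAt)
    (fun t ht => by
      have := (key t).hasDerivWithinAt (s := Ici t)
      rwa [hzero t (Ico_subset_Icc_self ht)] at this) 1 (by simp)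
  simpa using this

theorem ae_translate_eq {f : ℝ × ℝ → ℝ} {U : Set (ℝ × ℝ)}
    (hf : Integrable f) (hUo : IsOpen U) (hU : Convex ℝ U)
    (h0 : ∀ v : ℝ × ℝ, ∀ φ, IsTest φ → tsupport φ ⊆ U → ∫ x, f x * fderiv ℝ φ x v = 0)
    (h : ℝ × ℝ) : ∀ᵐ x : ℝ × ℝ, x ∈ U → x + h ∈ U → f (x + h) = f x := by
  have hV : IsOpen (U ∩ (fun x => x + h) ⁻¹' U) := hUo.inter (hUo.preimage (by fun_prop))
  have hfh : Integrable (fun x => f (x + h)) := hf.comp_add_right h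
  have := hV.ae_eq_zero_of_integral_contDiff_smul_eq_zero (μ := (volume : Measure (ℝ × ℝ)))
    (f := fun x => f (x + h) - f x) ((hfh.sub hf).locallyIntegrable.locallyIntegrableOn _) ?_
  · filter_upwards [this] with x hx h1 h2
    exact sub_eq_zero.1 (hx ⟨h1, h2⟩)
  · intro ψ h1 h2 h3
    have hψ : IsTest ψ := ⟨h1, h2⟩
    have e1 : ∫ x, f (x + h) * ψ x = ∫ x, f x * ψ (x - h) := by
      rw [← integral_add_right_eq_self (fun x => f x * ψ (x - h)) h]
      simp
    have e2 := integral_mul_comp_sub_const hf hU h0 h hψ fun x hx => h3 hx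
    calc ∫ x, ψ x • (f (x + h) - f x) = ∫ x, (f (x + h) * ψ x - f x * ψ x) := by
          congr 1; ext x; simp only [smul_eq_mul]; ring
      _ = 0 := by
          rw [integral_sub (hψ.integrable_mul hfh) (hψ.integrable_mul hf), e1, e2, sub_self]

theorem exists_ae_eq_const {f : ℝ × ℝ → ℝ} {U : Set (ℝ × ℝ)}
    (hf : Integrable f) (hUo : IsOpen U) (hU : Convex ℝ U)
    (h0 : ∀ v : ℝ × ℝ, ∀ φ, IsTest φ → tsupport φ ⊆ U → ∫ x, f x * fderiv ℝ φ x v = 0) :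
    ∃ c, ∀ᵐ x : ℝ × ℝ, x ∈ U → f x = c := by
  rcases U.eq_empty_or_nonempty with rfl | hne
  · exact ⟨0, by simp⟩
  obtain ⟨g, hg, hfg⟩ := hf.1.aemeasurable
  have h1 : ∀ h : ℝ × ℝ, ∀ᵐ x : ℝ × ℝ, x ∈ U → x + h ∈ U → g (x + h) = g x := by
    intro h
    have := (measurePreserving_add_right (volume : Measure (ℝ × ℝ)) h).quasiMeasurePreserving.ae hfg
    filter_upwards [ae_translate_eq hf hUo hU h0 h, hfg, this] with x h1 h2 h3 hx hxh
    rw [← h3, ← h2, h1 hx hxh]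
  have hmeas : MeasurableSet {q : (ℝ × ℝ) × (ℝ × ℝ) |
      q.2 ∈ U → q.2 + q.1 ∈ U → g (q.2 + q.1) = g q.2} := by
    have m1 : MeasurableSet {q : (ℝ × ℝ) × (ℝ × ℝ) | q.2 ∈ U} := measurable_snd hUo.measurableSet
    have m2 : MeasurableSet {q : (ℝ × ℝ) × (ℝ × ℝ) | q.2 + q.1 ∈ U} :=
      (measurable_snd.add measurable_fst) hUo.measurableSet
    have m3 : MeasurableSet {q : (ℝ × ℝ) × (ℝ × ℝ) | g (q.2 + q.1) = g q.2} :=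
      measurableSet_eq_fun (hg.comp (measurable_snd.add measurable_fst)) (hg.comp measurable_snd)
    exact m1.imp (m2.imp m3)
  have h2 := (Measure.ae_ae_comm (μ := (volume : Measure (ℝ × ℝ)))
    (ν := (volume : Measure (ℝ × ℝ)))
    (p := fun h x => x ∈ U → x + h ∈ U → g (x + h) = g x) hmeas).1 (ae_of_all _ h1)
  obtain ⟨x, hxU, hx⟩ := exists_mem_of_ae hUo hne (h2.mono fun x hx _ => hx)
  refine ⟨g x, ?_⟩
  have := (measurePreserving_add_right (volume : Measure (ℝ × ℝ))
    (-x)).quasiMeasurePreserving.ae hx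
  filter_upwards [this, hfg] with y hy hfy hyU
  have e : x + (y + -x) = y := by abel
  rw [e] at hy
  rw [hfy, hy hxU hyU]

end LocallyConstant

section Decompositions

theorem integrable_ind_of_memM0 {A : Set (ℝ × ℝ)} {m : SignedMeasure (ℝ × ℝ)}
    (h : MemM0 (ind A) m) : Integrable (ind A) := by
  have hbox : MeasurableSet {q : (ℝ × ℝ) × (ℝ × ℝ) |
      q.2 ∈ Icc (0 : ℝ) q.1.1 ×ˢ Icc (0 : ℝ) q.1.2} := by
    simp only [Set.mem_prod, mem_Icc]
    measurability
  have hm : ∀ κ : Measure (ℝ × ℝ), IsFiniteMeasure κ →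
      Measurable fun x : ℝ × ℝ => (κ (Icc (0 : ℝ) x.1 ×ˢ Icc (0 : ℝ) x.2)).toReal :=
    fun κ _ => (measurable_measure_prodMk_left (ν := κ) hbox).ennreal_toReal
  have hmm : Measurable fun x : ℝ × ℝ => m (Icc (0 : ℝ) x.1 ×ˢ Icc (0 : ℝ) x.2) := by
    have e : (fun x : ℝ × ℝ => m (Icc (0 : ℝ) x.1 ×ˢ Icc (0 : ℝ) x.2)) = fun x =>
        (m.toJordanDecomposition.posPart (Icc (0 : ℝ) x.1 ×ˢ Icc (0 : ℝ) x.2)).toReal -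
        (m.toJordanDecomposition.negPart (Icc (0 : ℝ) x.1 ×ˢ Icc (0 : ℝ) x.2)).toReal := by
      ext x
      have hs : MeasurableSet (Icc (0 : ℝ) x.1 ×ˢ Icc (0 : ℝ) x.2) :=
        measurableSet_Icc.prod measurableSet_Icc
      nth_rw 1 [eq_posPart_sub_negPart m]
      rw [_root_.sub_apply, Measure.toSignedMeasure_apply_measurable hs,
        Measure.toSignedMeasure_apply_measurable hs]
      rfl
    rw [e]
    exact (hm _ inferInstance).sub (hm _ inferInstance)
  have hK : Integrable (K2.indicator fun _ => (1 : ℝ)) :=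
    (integrable_indicator_iff (measurableSet_Icc.prod measurableSet_Icc)).2
      (integrableOn_const (isCompact_Icc.prod isCompact_Icc).measure_ne_top)
  refine hK.mono' (hmm.aestronglyMeasurable.congr (h.2.2.2.mono fun x hx => hx.symm))
    (ae_of_all _ fun x => ?_)
  by_cases hx : x ∈ K2
  · rw [indicator_of_mem hx]
    rcases ind_eq_zero_or_one A x with h | h <;> simp [h]
  · rw [indicator_of_notMem hx, h.2.2.1 x hx, norm_zero]

theorem ind_union_apply {A₁ A₂ : Set (ℝ × ℝ)} (hd : A₁ ∩ A₂ = ∅) (x : ℝ × ℝ) :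
    ind (A₁ ∪ A₂) x = ind A₁ x + ind A₂ x :=
  congr_fun (indicator_union_of_disjoint (Set.disjoint_iff_inter_eq_empty.2 hd) _) x

theorem integral_ind_union_mul {A₁ A₂ : Set (ℝ × ℝ)} (hd : A₁ ∩ A₂ = ∅)
    (h₁ : Integrable (ind A₁)) (h₂ : Integrable (ind A₂)) {φ : ℝ × ℝ → ℝ} (hφ : IsTest φ) :
    ∫ x, ind (A₁ ∪ A₂) x * φ x = (∫ x, ind A₁ x * φ x) + ∫ x, ind A₂ x * φ x := by
  rw [← integral_add (hφ.integrable_mul h₁) (hφ.integrable_mul h₂)]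
  simp only [ind_union_apply hd, add_mul]

theorem TV_add_le (μ ν : SignedMeasure (ℝ × ℝ)) : TV (μ + ν) ≤ TV μ + TV ν := by
  unfold TV
  rw [← ENNReal.toReal_add (measure_ne_top _ _) (measure_ne_top _ _)]
  exact ENNReal.toReal_mono (ENNReal.add_ne_top.2
    ⟨measure_ne_top _ _, measure_ne_top _ _⟩)
    (totalVariation_add_le μ ν univ)

theorem TV_add_eq_iff (μ ν : SignedMeasure (ℝ × ℝ)) : TV (μ + ν) = TV μ + TV ν ↔
    (μ + ν).totalVariation univ = μ.totalVariation univ + ν.totalVariation univ := by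
  unfold TV
  rw [← ENNReal.toReal_add (measure_ne_top _ _) (measure_ne_top _ _),
    ENNReal.toReal_eq_toReal_iff' (measure_ne_top _ _) (ENNReal.add_ne_top.2
    ⟨measure_ne_top _ _, measure_ne_top _ _⟩)]

theorem eq_add_of_isDeriv {A₁ A₂ : Set (ℝ × ℝ)} (hd : A₁ ∩ A₂ = ∅)
    (h₁ : Integrable (ind A₁)) (h₂ : Integrable (ind A₂)) (v : ℝ × ℝ)
    {ν ν₁ ν₂ : SignedMeasure (ℝ × ℝ)}
    (hν : ∀ φ, IsTest φ → ∫ x, ind (A₁ ∪ A₂) x * fderiv ℝ φ x v = - sInt ν φ)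
    (hν₁ : ∀ φ, IsTest φ → ∫ x, ind A₁ x * fderiv ℝ φ x v = - sInt ν₁ φ)
    (hν₂ : ∀ φ, IsTest φ → ∫ x, ind A₂ x * fderiv ℝ φ x v = - sInt ν₂ φ) : ν = ν₁ + ν₂ := by
  refine eq_add_of_sInt_eq fun φ hφ => ?_
  have := integral_ind_union_mul hd h₁ h₂ (hφ.fderiv_apply v)
  rw [hν φ hφ, hν₁ φ hφ, hν₂ φ hφ] at this
  linarith

theorem integral_ind_mul_fderiv_eq_zero {A : Set (ℝ × ℝ)} {U : Set (ℝ × ℝ)}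
    (hcov : ∀ᵐ y : ℝ × ℝ, y ∈ U → y ∈ A) {φ : ℝ × ℝ → ℝ} (hφ : IsTest φ)
    (hφU : tsupport φ ⊆ U) (v : ℝ × ℝ) : ∫ x, ind A x * fderiv ℝ φ x v = 0 := by
  rw [← hφ.integral_fderiv v]
  refine integral_congr_ae (hcov.mono fun x hx => ?_)
  by_cases hxU : x ∈ U
  · simp [ind, hx hxU]
  · have : x ∉ tsupport (fderiv ℝ φ) := fun h => hxU (hφU (tsupport_fderiv_subset ℝ h))
    simp [image_eq_zero_of_notMem_tsupport this]

/-- If no cancellation occurs in the sum of the derivatives, a convex region almost covered by the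
union carries no derivative of either part. -/
theorem integral_ind_left_mul_fderiv_eq_zero {A₁ A₂ : Set (ℝ × ℝ)} {v : ℝ × ℝ}
    {ν ν₁ ν₂ : SignedMeasure (ℝ × ℝ)}
    (hν : ∀ φ, IsTest φ → ∫ x, ind (A₁ ∪ A₂) x * fderiv ℝ φ x v = - sInt ν φ)
    (hν₁ : ∀ φ, IsTest φ → ∫ x, ind A₁ x * fderiv ℝ φ x v = - sInt ν₁ φ)
    (hadd : ν = ν₁ + ν₂) (hTV : TV (ν₁ + ν₂) = TV ν₁ + TV ν₂)
    {U : Set (ℝ × ℝ)} (hU : IsOpen U) (hcov : ∀ᵐ y : ℝ × ℝ, y ∈ U → y ∈ A₁ ∪ A₂)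
    {φ : ℝ × ℝ → ℝ} (hφ : IsTest φ) (hφU : tsupport φ ⊆ U) :
    ∫ x, ind A₁ x * fderiv ℝ φ x v = 0 := by
  have h0 : ν.totalVariation U = 0 := totalVariation_eq_zero_of_sInt_eq_zero hU
    fun ψ hψ hψU => by
      rw [← neg_eq_zero, ← hν ψ hψ, integral_ind_mul_fderiv_eq_zero hcov hψ hψU v]
  have h1 := totalVariation_le_of_add ν₁ ν₂ ((TV_add_eq_iff _ _).1 hTV) hU.measurableSet
  rw [← hadd, h0, nonpos_iff_eq_zero] at h1
  rw [hν₁ φ hφ, sInt_eq_zero_of_totalVariation h1 hφU, neg_zero]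

theorem NablaDecomp.separated {A A₁ A₂ : Set (ℝ × ℝ)} (h : NablaDecomp A A₁ A₂) :
    Separated A₁ A₂ := by
  obtain ⟨⟨rfl, hd, -, -⟩, ⟨m₁, hm₁⟩, ⟨m₂, hm₂⟩, r, r₁, r₂, ⟨ν, κ, hν, hκ, rfl⟩,
    ⟨ν₁, κ₁, hν₁, hκ₁, rfl⟩, ⟨ν₂, κ₂, hν₂, hκ₂, rfl⟩, hr⟩ := h
  have hi₁ := integrable_ind_of_memM0 hm₁
  have hi₂ := integrable_ind_of_memM0 hm₂
  have eν := eq_add_of_isDeriv hd hi₁ hi₂ (1, 0) hν hν₁ hν₂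
  have eκ := eq_add_of_isDeriv hd hi₁ hi₂ (0, 1) hκ hκ₁ hκ₂
  have lν := TV_add_le ν₁ ν₂
  have lκ := TV_add_le κ₁ κ₂
  rw [eν, eκ] at hr
  have tν : TV (ν₁ + ν₂) = TV ν₁ + TV ν₂ := by linarith
  have tκ : TV (κ₁ + κ₂) = TV κ₁ + TV κ₂ := by linarith
  intro U hU hUc hcov
  obtain ⟨c, hc⟩ := exists_ae_eq_const hi₁ hU hUc fun v φ hφ hφU => by
    have e : ∀ x, ind A₁ x * fderiv ℝ φ x v =
        v.1 * (ind A₁ x * fderiv ℝ φ x (1, 0)) + v.2 * (ind A₁ x * fderiv ℝ φ x (0, 1)) := by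
      intro x
      have : v = v.1 • ((1, 0) : ℝ × ℝ) + v.2 • ((0, 1) : ℝ × ℝ) := by ext <;> simp
      conv_lhs => rw [this]
      rw [map_add, map_smul, map_smul, smul_eq_mul, smul_eq_mul]
      ring
    simp only [e]
    rw [integral_add (((hφ.fderiv_apply _).integrable_mul hi₁).const_mul _)
      (((hφ.fderiv_apply _).integrable_mul hi₁).const_mul _), integral_const_mul,
      integral_const_mul, integral_ind_left_mul_fderiv_eq_zero hν hν₁ eν tν hU hcov hφ hφU,
      integral_ind_left_mul_fderiv_eq_zero hκ hκ₁ eκ tκ hU hcov hφ hφU]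
    simp
  by_cases h1 : c = 1
  · right
    filter_upwards [hc] with y hy hyU hy2
    have hy1 : y ∈ A₁ := ind_eq_one_iff.1 ((hy hyU).trans h1)
    exact (hd ▸ (⟨hy1, hy2⟩ : y ∈ A₁ ∩ A₂) : y ∈ (∅ : Set (ℝ × ℝ)))
  · left
    filter_upwards [hc] with y hy hyU hy1
    exact h1 ((hy hyU).symm.trans (ind_eq_one_iff.2 hy1))

theorem isMixedDeriv_union {A₁ A₂ : Set (ℝ × ℝ)} (hd : A₁ ∩ A₂ = ∅)
    {m₁ m₂ : SignedMeasure (ℝ × ℝ)} (h₁ : MemM0 (ind A₁) m₁) (h₂ : MemM0 (ind A₂) m₂) :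
    IsMixedDeriv (ind (A₁ ∪ A₂)) (m₁ + m₂) := fun φ hφ => by
  have := integral_ind_union_mul hd (integrable_ind_of_memM0 h₁) (integrable_ind_of_memM0 h₂)
    ((hφ.fderiv_apply (0, 1)).fderiv_apply (1, 0))
  rw [sInt_add _ _ hφ, ← h₁.1 φ hφ, ← h₂.1 φ hφ]
  exact this

theorem memM0_union {A₁ A₂ : Set (ℝ × ℝ)} (hd : A₁ ∩ A₂ = ∅)
    {m₁ m₂ : SignedMeasure (ℝ × ℝ)} (h₁ : MemM0 (ind A₁) m₁) (h₂ : MemM0 (ind A₂) m₂) :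
    MemM0 (ind (A₁ ∪ A₂)) (m₁ + m₂) := by
  refine ⟨isMixedDeriv_union hd h₁ h₂, ?_, fun x hx => ?_, ?_⟩
  · refine le_antisymm ((totalVariation_add_le m₁ m₂ _).trans ?_) zero_le
    rw [Measure.add_apply, h₁.2.1, h₂.2.1, add_zero]
  · rw [ind_union_apply hd, h₁.2.2.1 x hx, h₂.2.2.1 x hx, add_zero]
  · filter_upwards [h₁.2.2.2, h₂.2.2.2] with x hx₁ hx₂
    rw [ind_union_apply hd, hx₁, hx₂, _root_.add_apply]

theorem NablaDecomp.ddDecomp {A A₁ A₂ : Set (ℝ × ℝ)} (h : NablaDecomp A A₁ A₂) :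
    DDDecomp A A₁ A₂ := by
  have hs := h.separated
  obtain ⟨⟨rfl, hd, hv₁, hv₂⟩, ⟨m₁, hm₁⟩, ⟨m₂, hm₂⟩, -⟩ := h
  obtain ⟨C₁, hC₁, hz₁⟩ := exists_countable_totalVariation_compl_eq_zero hm₁
  obtain ⟨C₂, hC₂, hz₂⟩ := exists_countable_totalVariation_compl_eq_zero hm₂
  refine ⟨⟨rfl, hd, hv₁, hv₂⟩, ⟨m₁, hm₁⟩, ⟨m₂, hm₂⟩, m₁ + m₂, m₁, m₂,
    isMixedDeriv_union hd hm₁ hm₂, hm₁.1, hm₂.1, ((TV_add_eq_iff _ _).2 ?_).symm⟩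
  exact totalVariation_univ_add_of_atomic m₁ m₂ (hC₁.union hC₂)
    (measure_mono_null (compl_subset_compl.2 subset_union_left) hz₁)
    (measure_mono_null (compl_subset_compl.2 subset_union_right) hz₂)
    (mul_apply_singleton_nonneg hm₁ hm₂ hd hs)

end Decompositions

section Example

/-- The mixed derivative of the indicator of the rectangle `[a, b) × [c, d)`. -/
def rectM (a b c d : ℝ) : SignedMeasure (ℝ × ℝ) :=
  (Measure.dirac (a, c) + Measure.dirac (b, d)).toSignedMeasure -
    (Measure.dirac (b, c) + Measure.dirac (a, d)).toSignedMeasure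

theorem rectM_apply (a b c d : ℝ) {s : Set (ℝ × ℝ)} (hs : MeasurableSet s) :
    rectM a b c d s = s.indicator 1 (a, c) + s.indicator 1 (b, d) -
      (s.indicator 1 (b, c) + s.indicator 1 (a, d)) := by
  have h : ∀ p : ℝ × ℝ, (s.indicator 1 p : ENNReal).toReal = s.indicator 1 p := fun p => by
    by_cases hp : p ∈ s <;> simp [hp]
  have hf : ∀ p : ℝ × ℝ, (s.indicator 1 p : ENNReal) ≠ ⊤ := fun p => by
    by_cases hp : p ∈ s <;> simp [hp]
  rw [rectM, _root_.sub_apply, Measure.toSignedMeasure_apply_measurable hs,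
    Measure.toSignedMeasure_apply_measurable hs, Measure.real, Measure.real, Measure.add_apply,
    Measure.add_apply, Measure.dirac_apply' _ hs, Measure.dirac_apply' _ hs,
    Measure.dirac_apply' _ hs, Measure.dirac_apply' _ hs, ENNReal.toReal_add (hf _) (hf _),
    ENNReal.toReal_add (hf _) (hf _), h, h, h, h]

theorem totalVariation_rectM_eq_zero {a b c d : ℝ} {s : Set (ℝ × ℝ)} (hs : MeasurableSet s)
    (h : ∀ x ∈ ({a, b} : Set ℝ), ∀ y ∈ ({c, d} : Set ℝ), (x, y) ∉ s) :
    (rectM a b c d).totalVariation s = 0 := by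
  rw [totalVariation_eq_zero_iff _ hs]
  intro t hts ht
  rw [rectM_apply a b c d ht, indicator_of_notMem (fun hp => h a (by simp) c (by simp) (hts hp)),
    indicator_of_notMem (fun hp => h b (by simp) d (by simp) (hts hp)),
    indicator_of_notMem (fun hp => h b (by simp) c (by simp) (hts hp)),
    indicator_of_notMem (fun hp => h a (by simp) d (by simp) (hts hp))]
  simp

theorem IsTest.intervalIntegral_fst {φ : ℝ × ℝ → ℝ} (hφ : IsTest φ) (a b y : ℝ) :
    ∫ x in a..b, pd1 φ (x, y) = φ (b, y) - φ (a, y) := by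
  refine intervalIntegral.integral_eq_sub_of_hasDerivAt (f := fun x => φ (x, y)) (fun x _ => ?_)
    (((hφ.fderiv_apply (1, 0)).1.continuous.comp (by fun_prop)).intervalIntegrable _ _)
  exact (hφ.differentiable (x, y)).hasFDerivAt.comp_hasDerivAt x
    ((hasDerivAt_id x).prodMk (hasDerivAt_const x y))

theorem IsTest.intervalIntegral_snd {φ : ℝ × ℝ → ℝ} (hφ : IsTest φ) (x c d : ℝ) :
    ∫ y in c..d, pd2 φ (x, y) = φ (x, d) - φ (x, c) := by
  refine intervalIntegral.integral_eq_sub_of_hasDerivAt (f := fun y => φ (x, y)) (fun y _ => ?_)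
    (((hφ.fderiv_apply (0, 1)).1.continuous.comp (by fun_prop)).intervalIntegrable _ _)
  exact (hφ.differentiable (x, y)).hasFDerivAt.comp_hasDerivAt y
    ((hasDerivAt_const y x).prodMk (hasDerivAt_id y))

theorem isMixedDeriv_rect {a b c d : ℝ} (hab : a ≤ b) (hcd : c ≤ d) :
    IsMixedDeriv (ind (Ico a b ×ˢ Ico c d)) (rectM a b c d) := by
  intro φ hφ
  have h2 : IsTest (pd2 φ) := hφ.fderiv_apply (0, 1)
  have h1 : IsTest (pd1 (pd2 φ)) := h2.fderiv_apply (1, 0)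
  have e : ∀ x, ind (Ico a b ×ˢ Ico c d) x * pd1 (pd2 φ) x =
      (Ico a b ×ˢ Ico c d).indicator (pd1 (pd2 φ)) x := fun x => by
    by_cases hx : x ∈ Ico a b ×ˢ Ico c d
    · rw [ind, indicator_of_mem hx, indicator_of_mem hx, one_mul]
    · rw [ind, indicator_of_notMem hx, indicator_of_notMem hx, zero_mul]
  have hi : ∀ x, IntervalIntegrable (fun y => pd2 φ (x, y)) volume c d := fun x =>
    (h2.1.continuous.comp (by fun_prop)).intervalIntegrable _ _
  have hψ : Integrable (pd1 (pd2 φ))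
      ((volume.restrict (Ico a b)).prod (volume.restrict (Ico c d))) := by
    rw [Measure.prod_restrict]
    exact h1.integrable.integrableOn
  simp only [e]
  rw [integral_indicator (measurableSet_Ico.prod measurableSet_Ico), Measure.volume_eq_prod,
    ← Measure.prod_restrict, integral_prod_symm _ hψ]
  simp only [integral_Ico_eq_integral_Ioc, ← intervalIntegral.integral_of_le hab,
    ← intervalIntegral.integral_of_le hcd]
  simp only [h2.intervalIntegral_fst]
  rw [intervalIntegral.integral_sub (hi b) (hi a), hφ.intervalIntegral_snd,
    hφ.intervalIntegral_snd, sInt_eq_sub (μ := rectM a b c d) rfl hφ,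
    integral_add_measure hφ.integrable hφ.integrable,
    integral_add_measure hφ.integrable hφ.integrable]
  simp only [integral_dirac]
  ring

theorem memM0_rect {a b c d : ℝ} (ha : 0 ≤ a) (hab : a < b) (hb : b ≤ 1) (hc : 0 ≤ c)
    (hcd : c < d) (hd : d ≤ 1) : MemM0 (ind (Ico a b ×ˢ Ico c d)) (rectM a b c d) := by
  refine ⟨isMixedDeriv_rect hab.le hcd.le, ?_, fun x hx => indicator_of_notMem (fun h => hx ?_) _,
    ae_of_all _ fun x => ?_⟩
  · refine totalVariation_rectM_eq_zero (measurableSet_Icc.prod measurableSet_Icc).compl ?_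
    rintro x (rfl | rfl) y (rfl | rfl) h <;>
      exact h ⟨⟨by linarith, by linarith⟩, ⟨by linarith, by linarith⟩⟩
  · exact ⟨⟨ha.trans h.1.1, h.1.2.le.trans hb⟩, ⟨hc.trans h.2.1, h.2.2.le.trans hd⟩⟩
  · rw [rectM_apply _ _ _ _ (measurableSet_Icc.prod measurableSet_Icc)]
    have hb0 : 0 ≤ b := ha.trans hab.le
    have hd0 : 0 ≤ d := hc.trans hcd.le
    have i1 : b ≤ x.1 → a ≤ x.1 := hab.le.trans
    have i2 : d ≤ x.2 → c ≤ x.2 := hcd.le.trans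
    simp only [ind, indicator, Set.mem_prod, mem_Ico, mem_Icc, ha, hb0, hc, hd0, true_and,
      Pi.one_apply, ← not_le]
    by_cases c1 : a ≤ x.1 <;> by_cases c2 : b ≤ x.1 <;> by_cases c3 : c ≤ x.2 <;>
      by_cases c4 : d ≤ x.2 <;> revert i1 i2 <;> simp only [c1, c2, c3, c4] <;> norm_num

theorem volume_rect_pos {a b c d : ℝ} (hab : a < b) (hcd : c < d) :
    0 < volume (Ico a b ×ˢ Ico c d : Set (ℝ × ℝ)) := by
  rw [Measure.volume_eq_prod, Measure.prod_prod, Real.volume_Ico, Real.volume_Ico]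
  exact ENNReal.mul_pos (by simpa using hab) (by simpa using hcd)

abbrev leftRect : Set (ℝ × ℝ) := Ico 0 (1 / 2) ×ˢ Ico 0 1

abbrev rightRect : Set (ℝ × ℝ) := Ico (1 / 2) 1 ×ˢ Ico (1 / 4) (3 / 4)

theorem leftRect_inter_rightRect : leftRect ∩ rightRect = ∅ := by
  ext x
  simp only [mem_inter_iff, Set.mem_prod, mem_Ico, mem_empty_iff_false, iff_false]
  rintro ⟨⟨h1, -⟩, ⟨h2, -⟩⟩
  linarith [h1.2, h2.1]

theorem memM0_leftRect : MemM0 (ind leftRect) (rectM 0 (1 / 2) 0 1) :=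
  memM0_rect (by norm_num) (by norm_num) (by norm_num) (by norm_num) (by norm_num) (by norm_num)

theorem memM0_rightRect : MemM0 (ind rightRect) (rectM (1 / 2) 1 (1 / 4) (3 / 4)) :=
  memM0_rect (by norm_num) (by norm_num) (by norm_num) (by norm_num) (by norm_num) (by norm_num)

theorem ddDecomp_leftRect_union_rightRect :
    DDDecomp (leftRect ∪ rightRect) leftRect rightRect := by
  refine ⟨⟨rfl, leftRect_inter_rightRect, volume_rect_pos (by norm_num) (by norm_num),
    volume_rect_pos (by norm_num) (by norm_num)⟩, ⟨_, memM0_leftRect⟩,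
    ⟨_, memM0_rightRect⟩, _, _, _,
    isMixedDeriv_union leftRect_inter_rightRect memM0_leftRect memM0_rightRect, memM0_leftRect.1,
    memM0_rightRect.1, ((TV_add_eq_iff _ _).2 ?_).symm⟩
  have hC : (({0, 1 / 2, 1} : Set ℝ) ×ˢ ({0, 1 / 4, 3 / 4, 1} : Set ℝ)).Finite :=
    (toFinite _).prod (toFinite _)
  refine totalVariation_univ_add_of_atomic _ _ hC.countable
    (totalVariation_rectM_eq_zero hC.measurableSet.compl ?_)
    (totalVariation_rectM_eq_zero hC.measurableSet.compl ?_) fun p => ?_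
  · rintro x (rfl | rfl) y (rfl | rfl) <;> simp
  · rintro x (rfl | rfl) y (rfl | rfl) <;> simp
  · by_cases hp : p.2 = 0 ∨ p.2 = 1
    · have : rectM (1 / 2) 1 (1 / 4) (3 / 4) {p} = 0 :=
        apply_eq_zero_of_totalVariation _ (totalVariation_rectM_eq_zero (measurableSet_singleton p)
          (by
            rintro x - y (rfl | rfl) rfl <;> norm_num at hp))
      rw [this, mul_zero]
    · have : rectM 0 (1 / 2) 0 1 {p} = 0 :=
        apply_eq_zero_of_totalVariation _ (totalVariation_rectM_eq_zero (measurableSet_singleton p)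
          (by
            rintro x - y (rfl | rfl) rfl <;> norm_num at hp))
      rw [this, zero_mul]

theorem not_separated_of_union_eq {A₁ A₂ : Set (ℝ × ℝ)} (hA : A₁ ∪ A₂ = leftRect ∪ rightRect)
    (h₁ : 0 < volume A₁) (h₂ : 0 < volume A₂) : ¬ Separated A₁ A₂ := by
  intro hs
  have hU : ∀ U : Set (ℝ × ℝ), U ⊆ A₁ ∪ A₂ → ∀ᵐ y : ℝ × ℝ, y ∈ U → y ∈ A₁ ∪ A₂ :=
    fun U h => ae_of_all _ fun y hy => h hy
  have sub₁ : (Ioo 0 (1 / 2) ×ˢ Ioo 0 1 : Set (ℝ × ℝ)) ⊆ A₁ ∪ A₂ := by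
    rw [hA]
    exact (Set.prod_mono Ioo_subset_Ico_self Ioo_subset_Ico_self).trans subset_union_left
  have sub₂ : (Ioo 0 1 ×ˢ Ioo (1 / 4) (3 / 4) : Set (ℝ × ℝ)) ⊆ A₁ ∪ A₂ := by
    rw [hA]
    rintro x ⟨⟨h1, h2⟩, ⟨h3, h4⟩⟩
    rcases lt_or_ge x.1 (1 / 2) with h | h
    · exact Or.inl ⟨⟨h1.le, h⟩, ⟨by linarith, by linarith⟩⟩
    · exact Or.inr ⟨⟨h, h2⟩, ⟨h3.le, h4⟩⟩
  have cov : ∀ᵐ y : ℝ × ℝ, y ∈ A₁ ∪ A₂ → y ∈ (Ioo 0 (1 / 2) ×ˢ Ioo 0 1 : Set (ℝ × ℝ)) ∪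
      Ioo 0 1 ×ˢ Ioo (1 / 4) (3 / 4) := by
    rw [hA]
    filter_upwards [ae_fst_ne 0, ae_snd_ne 0, ae_snd_ne (1 / 4)] with y h1 h2 h3
    rintro (⟨⟨a, b⟩, ⟨c, d⟩⟩ | ⟨⟨a, b⟩, ⟨c, d⟩⟩)
    · exact Or.inl ⟨⟨lt_of_le_of_ne a h1.symm, b⟩, ⟨lt_of_le_of_ne c h2.symm, d⟩⟩
    · exact Or.inr ⟨⟨by linarith, b⟩, ⟨lt_of_le_of_ne c h3.symm, d⟩⟩
  have meet : ∀ B₁ B₂ : Set (ℝ × ℝ), B₁ ∪ B₂ = A₁ ∪ A₂ →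
      (∀ᵐ y : ℝ × ℝ, y ∈ (Ioo 0 (1 / 2) ×ˢ Ioo 0 1 : Set (ℝ × ℝ)) → y ∉ B₁) →
      ¬ ∀ᵐ y : ℝ × ℝ, y ∈ (Ioo 0 1 ×ˢ Ioo (1 / 4) (3 / 4) : Set (ℝ × ℝ)) → y ∉ B₂ := by
    intro B₁ B₂ hB k₁ k₂
    obtain ⟨y, hy, n₁, n₂⟩ := exists_mem_of_ae (Q := Ioo 0 (1 / 2) ×ˢ Ioo (1 / 4) (3 / 4))
      (P := fun y => y ∉ B₁ ∧ y ∉ B₂) (isOpen_Ioo.prod isOpen_Ioo)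
      ⟨(1 / 4, 1 / 2), by norm_num [Set.mem_prod]⟩ (by
        filter_upwards [k₁, k₂] with y k₁ k₂ hy
        exact ⟨k₁ ⟨hy.1, ⟨by linarith [hy.2.1], by linarith [hy.2.2]⟩⟩,
          k₂ ⟨⟨hy.1.1, by linarith [hy.1.2]⟩, hy.2⟩⟩)
    have : y ∈ B₁ ∪ B₂ := hB ▸ sub₁ ⟨hy.1, ⟨by linarith [hy.2.1], by linarith [hy.2.2]⟩⟩
    exact this.elim n₁ n₂
  have null : ∀ B : Set (ℝ × ℝ), B ⊆ A₁ ∪ A₂ →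
      (∀ᵐ y : ℝ × ℝ, y ∈ (Ioo 0 (1 / 2) ×ˢ Ioo 0 1 : Set (ℝ × ℝ)) → y ∉ B) →
      (∀ᵐ y : ℝ × ℝ, y ∈ (Ioo 0 1 ×ˢ Ioo (1 / 4) (3 / 4) : Set (ℝ × ℝ)) → y ∉ B) →
      volume B = 0 := by
    intro B hB k₁ k₂
    rw [measure_eq_zero_iff_ae_notMem]
    filter_upwards [cov, k₁, k₂] with y hy k₁ k₂ hyB
    exact (hy (hB hyB)).elim (fun h => k₁ h hyB) (fun h => k₂ h hyB)
  rcases hs _ (isOpen_Ioo.prod isOpen_Ioo) ((convex_Ioo _ _).prod (convex_Ioo _ _)) (hU _ sub₁)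
    with k₁ | k₁ <;>
  rcases hs _ (isOpen_Ioo.prod isOpen_Ioo) ((convex_Ioo _ _).prod (convex_Ioo _ _)) (hU _ sub₂)
    with k₂ | k₂
  · exact h₁.ne' (null A₁ subset_union_left k₁ k₂)
  · exact meet A₁ A₂ rfl k₁ k₂
  · exact meet A₂ A₁ (union_comm _ _) k₁ k₂
  · exact h₂.ne' (null A₂ subset_union_right k₁ k₂)

end Example

theorem stmt6 :
    (∀ A A1 A2 : Set (ℝ × ℝ), A ⊆ K2 → (∃ m, MemM0 (ind A) m) →
      NablaDecomp A A1 A2 → DDDecomp A A1 A2) ∧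
    (∀ A : Set (ℝ × ℝ), A ⊆ K2 → (∃ m, MemM0 (ind A) m) →
      (¬ ∃ A1 A2, DDDecomp A A1 A2) → ¬ ∃ A1 A2, NablaDecomp A A1 A2) ∧
    (∃ A : Set (ℝ × ℝ), A ⊆ K2 ∧ (∃ m, MemM0 (ind A) m) ∧
      (¬ ∃ A1 A2, NablaDecomp A A1 A2) ∧ ∃ A1 A2, DDDecomp A A1 A2) := by
  refine ⟨fun A A1 A2 _ _ h => h.ddDecomp, fun A _ _ h => ?_, leftRect ∪ rightRect, ?_,
    ⟨_, memM0_union leftRect_inter_rightRect memM0_leftRect memM0_rightRect⟩, ?_, _, _,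
    ddDecomp_leftRect_union_rightRect⟩
  · rintro ⟨A1, A2, h'⟩
    exact h ⟨A1, A2, h'.ddDecomp⟩
  · rintro x (⟨⟨a, b⟩, ⟨c, d⟩⟩ | ⟨⟨a, b⟩, ⟨c, d⟩⟩) <;>
      exact ⟨⟨by linarith, by linarith⟩, ⟨by linarith, by linarith⟩⟩
  · rintro ⟨A1, A2, h⟩
    exact not_separated_of_union_eq h.1.1 h.1.2.2.1 h.1.2.2.2 h.separated
end
end
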